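/- arXiv:2106.08757 — 13 statements merged into one kernel-verified Lean document; each statement's English description precedes it below -/
import Mathlib

section
/- Let 0<r<1 and let T be an invertible bounded linear operator on a complex Hilbert space H. Then T belongs to the class C_α if and only if rT⁻¹ belongs to C_α. -/
open ContinuousLinearMap

/-- The operator `α(T*,T) = -T*²T² + (1+r²)T*T - r²I`. -/
noncomputable def alphaOp {H : Type*} [NormedAddCommGroup H] [InnerProductSpace ℂ H]
    [CompleteSpace H] (r : ℝ) (T : H →L[ℂ] H) : H →L[ℂ] H :=
  -((adjoint T) ^ 2 * T ^ 2) + ((1 + r ^ 2 : ℝ) : ℂ) • (adjoint T * T)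
    - ((r ^ 2 : ℝ) : ℂ) • (1 : H →L[ℂ] H)

lemma alphaOp_inner {H : Type*} [NormedAddCommGroup H] [InnerProductSpace ℂ H]
    [CompleteSpace H] (r : ℝ) (T : H →L[ℂ] H) (x : H) :
    inner ℂ (alphaOp r T x) x
      = (((1 + r ^ 2) * ‖T x‖ ^ 2 - ‖T (T x)‖ ^ 2 - r ^ 2 * ‖x‖ ^ 2 : ℝ) : ℂ) := by
  have hm : ∀ (A B : H →L[ℂ] H) (y : H), (A * B) y = A (B y) := fun _ _ _ => rfl
  have ho : ∀ (y : H), (1 : H →L[ℂ] H) y = y := fun _ => rfl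
  simp only [alphaOp, pow_two (adjoint T), pow_two T, sub_apply, add_apply, neg_apply,
    hm, smul_apply, ho, inner_sub_left, inner_add_left, inner_neg_left,
    inner_smul_left, adjoint_inner_left, inner_self_eq_norm_sq_to_K, Complex.conj_ofReal]
  push_cast
  simp only [Complex.coe_algebraMap]
  ring

lemma alphaOp_pos_iff {H : Type*} [NormedAddCommGroup H] [InnerProductSpace ℂ H]
    [CompleteSpace H] (r : ℝ) (T : H →L[ℂ] H) :
    (alphaOp r T).IsPositive ↔
      ∀ x, 0 ≤ (1 + r ^ 2) * ‖T x‖ ^ 2 - ‖T (T x)‖ ^ 2 - r ^ 2 * ‖x‖ ^ 2 := by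
  rw [isPositive_iff_complex]
  refine forall_congr' fun x => ?_
  rw [alphaOp_inner]
  simp only [RCLike.re_eq_complex_re, Complex.ofReal_re]
  simp

/-- for an invertible `T` (with inverse `S`), `T ∈ C_α` iff `rT⁻¹ ∈ C_α`.
Both `T` and `rT⁻¹ = r • S` are invertible, so membership in `C_α` reduces to positivity
of the corresponding hereditary polynomial. -/
theorem stmt1 {H : Type*} [NormedAddCommGroup H] [InnerProductSpace ℂ H] [CompleteSpace H]
    (r : ℝ) (hr0 : 0 < r) (hr1 : r < 1)
    (T S : H →L[ℂ] H) (hTS : T * S = 1) (hST : S * T = 1) :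
    (IsUnit T ∧ (alphaOp r T).IsPositive) ↔
      (IsUnit ((r : ℂ) • S) ∧ (alphaOp r ((r : ℂ) • S)).IsPositive) := by
  have hrc : (r : ℂ) ≠ 0 := by exact_mod_cast hr0.ne'
  have h1 : IsUnit T := ⟨⟨T, S, hTS, hST⟩, rfl⟩
  have h2 : IsUnit ((r : ℂ) • S) :=
    ⟨⟨(r : ℂ) • S, (r : ℂ)⁻¹ • T, by rw [smul_mul_smul_comm, hST, mul_inv_cancel₀ hrc, one_smul],
      by rw [smul_mul_smul_comm, hTS, inv_mul_cancel₀ hrc, one_smul]⟩, rfl⟩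
  have a1 : ∀ x, T (S x) = x := fun x => by
    simpa using congrArg (fun A : H →L[ℂ] H => A x) hTS
  have a2 : ∀ x, S (T x) = x := fun x => by
    simpa using congrArg (fun A : H →L[ℂ] H => A x) hST
  have key : ∀ y, (1 + r ^ 2) * ‖((r : ℂ) • S) (T (T y))‖ ^ 2
      - ‖((r : ℂ) • S) (((r : ℂ) • S) (T (T y)))‖ ^ 2 - r ^ 2 * ‖T (T y)‖ ^ 2
      = r ^ 2 * ((1 + r ^ 2) * ‖T y‖ ^ 2 - ‖T (T y)‖ ^ 2 - r ^ 2 * ‖y‖ ^ 2) := by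
    intro y
    simp only [smul_apply, map_smul, a2, norm_smul, Complex.norm_real, Real.norm_eq_abs,
      abs_of_pos hr0]
    ring
  simp only [h1, h2, true_and, alphaOp_pos_iff]
  constructor
  · intro h x
    have := key (S (S x))
    simp only [a1] at this
    rw [this]
    have h3 := h (S (S x))
    simp only [a1] at h3
    positivity
  · intro h y
    have h3 := h (T (T y))
    rw [key] at h3
    exact nonneg_of_mul_nonneg_right h3 (by positivity)
end

section
/- Let 0<r<1 and let T be a bounded linear operator on a complex Hilbert space H belonging to the class C_α. Then ‖T‖ ≤ 1 and ‖T⁻¹‖ ≤ 1/r. -/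
open ContinuousLinearMap

lemma aux_norm {H : Type*} [NormedAddCommGroup H] [InnerProductSpace ℂ H]
    (T : H →L[ℂ] H) (c : ℝ) (h0 : 0 < ‖T‖) (h : ∀ z, ‖T z‖ ^ 2 ≤ c * ‖z‖ ^ 2) : ‖T‖ ^ 2 ≤ c := by
  have h1 : ‖T‖ ≤ Real.sqrt c := by
    refine T.opNorm_le_bound (Real.sqrt_nonneg _) fun z => ?_
    have := Real.le_sqrt_of_sq_le (h z)
    rwa [Real.sqrt_mul' _ (sq_nonneg _), Real.sqrt_sq (norm_nonneg _)] at this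
  exact (Real.le_sqrt' h0).1 h1

/-- if `T ∈ C_α` (i.e. `T` is invertible with inverse `S` and
`(1+r²)‖Tx‖² - ‖T²x‖² - r²‖x‖² ≥ 0` for all `x`, which expresses `α(T*,T) ≥ 0`),
then `‖T‖ ≤ 1` and `‖T⁻¹‖ ≤ 1/r`. -/
theorem stmt2 {H : Type*} [NormedAddCommGroup H] [InnerProductSpace ℂ H] [CompleteSpace H]
    (r : ℝ) (hr0 : 0 < r) (hr1 : r < 1)
    (T S : H →L[ℂ] H) (hTS : T * S = 1) (hST : S * T = 1)
    (hpos : ∀ x : H, 0 ≤ (1 + r ^ 2) * ‖T x‖ ^ 2 - ‖T (T x)‖ ^ 2 - r ^ 2 * ‖x‖ ^ 2) :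
    ‖T‖ ≤ 1 ∧ ‖S‖ ≤ 1 / r := by
  have e1 : ∀ z, T (S z) = z := fun z => by
    simpa using congrArg (fun A : H →L[ℂ] H => A z) hTS
  have e2 : ∀ z, S (T z) = z := fun z => by
    simpa using congrArg (fun A : H →L[ℂ] H => A z) hST
  constructor
  · by_contra! hc
    have h0 : 0 < ‖T‖ := by linarith
    have key := aux_norm T (1 + r ^ 2 - r ^ 2 / ‖T‖ ^ 2) h0 fun z => by
      have h1 := hpos (S z)
      rw [e1] at h1
      have h2 : ‖z‖ ≤ ‖T‖ * ‖S z‖ := by simpa [e1] using T.le_opNorm (S z)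
      have h3 : ‖z‖ ^ 2 / ‖T‖ ^ 2 ≤ ‖S z‖ ^ 2 := by
        rw [div_le_iff₀ (by positivity), ← mul_pow, mul_comm]
        gcongr
      have h4 := mul_le_mul_of_nonneg_left h3 (sq_nonneg r)
      have h5 : r ^ 2 / ‖T‖ ^ 2 * ‖z‖ ^ 2 = r ^ 2 * (‖z‖ ^ 2 / ‖T‖ ^ 2) := by ring
      linarith
    have hM : 1 < ‖T‖ ^ 2 := by nlinarith
    generalize ‖T‖ ^ 2 = M at key hM
    have h6 : r ^ 2 / M * M = r ^ 2 := by field_simp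
    have h7 := mul_le_mul_of_nonneg_right key (by linarith : 0 ≤ M)
    have h8 : 0 < (M - 1) * (M - r ^ 2) := mul_pos (by linarith) (by nlinarith)
    nlinarith
  · by_contra! hc
    have h0 : 0 < ‖S‖ := lt_trans (by positivity) hc
    have hc' : 1 < r * ‖S‖ := by rwa [div_lt_iff₀' hr0] at hc
    have key := aux_norm S ((1 + r ^ 2 - 1 / ‖S‖ ^ 2) / r ^ 2) h0 fun z => by
      have h1 := hpos (S z)
      rw [e1] at h1
      have h2 : ‖z‖ ≤ ‖S‖ * ‖T z‖ := by simpa [e2] using S.le_opNorm (T z)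
      have h3 : ‖z‖ ^ 2 / ‖S‖ ^ 2 ≤ ‖T z‖ ^ 2 := by
        rw [div_le_iff₀ (by positivity), ← mul_pow, mul_comm]
        gcongr
      have h5 : 1 / ‖S‖ ^ 2 * ‖z‖ ^ 2 = ‖z‖ ^ 2 / ‖S‖ ^ 2 := by ring
      rw [div_mul_eq_mul_div, le_div_iff₀ (by positivity)]
      linarith
    have hM : 1 < r ^ 2 * ‖S‖ ^ 2 := by nlinarith
    have hM0 : 0 < ‖S‖ ^ 2 := by positivity
    rw [le_div_iff₀ (by positivity)] at key
    generalize ‖S‖ ^ 2 = M at key hM hM0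
    have h6 : 1 / M * M = 1 := by field_simp
    have h7 := mul_le_mul_of_nonneg_right key hM0.le
    have hr2 : r ^ 2 < 1 := by nlinarith
    have h8 : 0 < (r ^ 2 * M - 1) * (M - 1) := mul_pos (by linarith) (by nlinarith)
    nlinarith
end

section
/- Let 0<r<1 and let T be a bounded linear operator on a complex Hilbert space H belonging to the class C_α. Then the spectrum of T is contained in the closed annulus {z ∈ ℂ : r ≤ |z| ≤ 1}, and for every x ∈ H the limits L⁺(T,x) := lim_{n→∞} ‖Tⁿx‖² and L⁻(T,x) := lim_{n→∞} ‖rⁿT⁻ⁿx‖² exist. -/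
open ContinuousLinearMap Filter

lemma aux_seq (q : ℝ) (hq0 : 0 ≤ q) (hq1 : q < 1) (a : ℕ → ℝ) (ha : ∀ n, 0 ≤ a n)
    (h : ∀ n, a (n+2) - a (n+1) ≤ q * (a (n+1) - a n)) :
    (∃ L, Tendsto a atTop (nhds L)) ∧ ∀ n, a n ≤ a 0 + a 1 / (1 - q) := by
  have h1 : 0 < 1 - q := by linarith
  have hd : ∀ n, a (n+1) - a n ≤ q ^ n * a 1 := by
    intro n
    induction n with
    | zero => have := ha 0; simp; linarith
    | succ k ih =>
      calc a (k+2) - a (k+1) ≤ q * (a (k+1) - a k) := h k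
        _ ≤ q * (q ^ k * a 1) := by gcongr
        _ = q ^ (k+1) * a 1 := by ring
  have hc : Antitone (fun n => a n + q ^ n * (a 1 / (1 - q))) := by
    apply antitone_nat_of_succ_le
    intro n
    have h2 := hd n
    have : q ^ n * (a 1 / (1-q)) - q ^ (n+1) * (a 1 / (1-q)) = q ^ n * a 1 := by
      field_simp
      ring
    linarith
  have hK : 0 ≤ a 1 / (1 - q) := div_nonneg (ha 1) h1.le
  have hnn : ∀ n, 0 ≤ q ^ n * (a 1 / (1 - q)) := fun n => mul_nonneg (pow_nonneg hq0 n) hK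
  constructor
  · have ht := tendsto_atTop_ciInf hc ⟨0, by
      rintro _ ⟨n, rfl⟩
      exact add_nonneg (ha n) (hnn n)⟩
    have h0 := (tendsto_pow_atTop_nhds_zero_of_lt_one hq0 hq1).mul_const (a 1 / (1 - q))
    refine ⟨_, (ht.sub h0).congr fun n => ?_⟩
    simp
  · intro n
    have := hc (Nat.zero_le n)
    have := hnn n
    simp only [pow_zero, one_mul] at *
    linarith

lemma aux_op {H : Type*} [NormedAddCommGroup H] [InnerProductSpace ℂ H] [CompleteSpace H]
    (r : ℝ) (hr0 : 0 < r) (hr1 : r < 1) (T : H →L[ℂ] H)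
    (hpos : ∀ x : H, 0 ≤ (1 + r ^ 2) * ‖T x‖ ^ 2 - ‖T (T x)‖ ^ 2 - r ^ 2 * ‖x‖ ^ 2) :
    (∀ z ∈ spectrum ℂ T, ‖z‖ ≤ 1) ∧
    (∀ x : H, ∃ L : ℝ, Tendsto (fun n : ℕ => ‖(T ^ n) x‖ ^ 2) atTop (nhds L)) := by
  have hq1 : r ^ 2 < 1 := by nlinarith
  have key := fun x : H => aux_seq (r^2) (by positivity) hq1 (fun n => ‖(T ^ n) x‖ ^ 2)
    (fun n => by positivity) (fun n => by
      have := hpos ((T ^ n) x)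
      simp only [pow_succ' T, ContinuousLinearMap.mul_apply] 
      linarith)
  refine ⟨fun z hz => ?_, fun x => (key x).1⟩
  obtain ⟨C, hC⟩ := banach_steinhaus (g := fun n : ℕ => T ^ n) (fun x =>
    ⟨Real.sqrt (‖(T ^ 0) x‖ ^ 2 + ‖(T ^ 1) x‖ ^ 2 / (1 - r ^ 2)), fun n =>
      Real.le_sqrt_of_sq_le ((key x).2 n)⟩)
  by_contra! hlt
  obtain ⟨n, hn⟩ := pow_unbounded_of_one_lt (C * ‖(1 : H →L[ℂ] H)‖) hlt
  have h1 := spectrum.norm_le_norm_mul_of_mem (spectrum.pow_mem_pow T n hz)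
  rw [norm_pow] at h1
  have := mul_le_mul_of_nonneg_right (hC n) (norm_nonneg (1 : H →L[ℂ] H))
  linarith

/-- if `T ∈ C_α` (i.e. `T` is invertible with inverse `S` and
`(1+r²)‖Tx‖² - ‖T²x‖² - r²‖x‖² ≥ 0` for all `x`), then the spectrum of `T` is contained
in the closed annulus `{r ≤ |z| ≤ 1}` and for every `x` the limits
`L⁺(T,x) = lim ‖Tⁿx‖²` and `L⁻(T,x) = lim ‖rⁿT⁻ⁿx‖²` exist. -/
theorem stmt3 {H : Type*} [NormedAddCommGroup H] [InnerProductSpace ℂ H] [CompleteSpace H]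
    (r : ℝ) (hr0 : 0 < r) (hr1 : r < 1)
    (T S : H →L[ℂ] H) (hTS : T * S = 1) (hST : S * T = 1)
    (hpos : ∀ x : H, 0 ≤ (1 + r ^ 2) * ‖T x‖ ^ 2 - ‖T (T x)‖ ^ 2 - r ^ 2 * ‖x‖ ^ 2) :
    (spectrum ℂ T ⊆ {z : ℂ | r ≤ ‖z‖ ∧ ‖z‖ ≤ 1}) ∧
    (∀ x : H, ∃ L : ℝ,
      Tendsto (fun n : ℕ => ‖(T ^ n) x‖ ^ 2) atTop (nhds L)) ∧
    (∀ x : H, ∃ L : ℝ,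
      Tendsto (fun n : ℕ => ‖(r ^ n : ℝ) • ((S ^ n) x)‖ ^ 2) atTop (nhds L)) := by
  have hTS' : ∀ x, T (S x) = x := fun x => by
    rw [← ContinuousLinearMap.mul_apply, hTS]; rfl
  have hR := aux_op r hr0 hr1 ((r : ℂ) • S) (fun x => by
    have h := hpos (S (S x))
    simp only [hTS'] at h
    have hr : ‖(r : ℂ)‖ = r := by simp [abs_of_pos hr0]
    simp only [ContinuousLinearMap.smul_apply, map_smul, norm_smul, hr]
    nlinarith [mul_nonneg (sq_nonneg r) h])
  have hT := aux_op r hr0 hr1 T hpos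
  refine ⟨fun z hz => ⟨?_, hT.1 z hz⟩, hT.2, fun x => ?_⟩
  · let u : (H →L[ℂ] H)ˣ := ⟨T, S, hTS, hST⟩
    have hz0 : z ≠ 0 := spectrum.ne_zero_of_mem_of_unit (a := u) hz
    have h1 : z⁻¹ ∈ spectrum ℂ S := by
      have := (spectrum.inv_mem_iff (r := Units.mk0 z hz0) (a := u)).1 hz
      simpa [u] using this
    have h2 : (r : ℂ) * z⁻¹ ∈ spectrum ℂ ((r : ℂ) • S) := by
      have hrc : (r : ℂ) ≠ 0 := by exact_mod_cast hr0.ne'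
      have := (spectrum.smul_mem_smul_iff (a := S) (s := z⁻¹) (r := Units.mk0 (r : ℂ) hrc)).2 h1
      simpa [Units.smul_def] using this
    have h3 := hR.1 _ h2
    have hzp : 0 < ‖z‖ := norm_pos_iff.2 hz0
    rw [norm_mul, norm_inv, Complex.norm_real, Real.norm_of_nonneg hr0.le,
      ← div_eq_mul_inv, div_le_one hzp] at h3
    exact h3
  · obtain ⟨L, hL⟩ := hR.2 x
    refine ⟨L, hL.congr fun n => ?_⟩
    rw [smul_pow, ContinuousLinearMap.smul_apply, norm_smul, norm_smul]
    simp
end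

section
/- Let 0<r<1 and let T be a bounded linear operator on a complex Hilbert space H belonging to the class C_α, with defect operator D. Then for every x ∈ H the series ∑_{n=1}^{∞} r^{2n−2}‖DT^{−n}x‖² converges and ∑_{n=1}^{∞} r^{2n−2}‖DT^{−n}x‖² = −‖Tx‖² + ‖x‖² + (r²−1)·L⁻(T,x). -/
open ContinuousLinearMap Filter

lemma aux_real (r : ℝ) (hr0 : 0 < r) (hr1 : r < 1) (f : ℕ → ℝ) (hf : ∀ n, 0 ≤ f n)
    (h : ∀ n, 0 ≤ (1 + r ^ 2) * f (n + 1) - f (n + 2) - r ^ 2 * f n) :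
    r ^ 2 * f 0 ≤ f 1 := by
  by_contra hc
  push Not at hc
  have h1 : ∀ n, f (n + 1) - r ^ 2 * f n ≤ f 1 - r ^ 2 * f 0 := by
    intro n
    induction n with
    | zero => simp
    | succ k ih => have := h k; linarith
  have h2 : ∀ n, f (n + 1) ≤ (r ^ 2) ^ (n + 1) * f 0 + (f 1 - r ^ 2 * f 0) := by
    intro n
    induction n with
    | zero => simp
    | succ k ih =>
      have a := h1 (k + 1)
      have b := mul_le_mul_of_nonneg_left ih (sq_nonneg r)
      have c : r ^ 2 * (f 1 - r ^ 2 * f 0) ≤ 0 :=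
        mul_nonpos_of_nonneg_of_nonpos (sq_nonneg r) (by linarith)
      rw [pow_succ (r ^ 2) (k + 1)]
      linarith
  have ht : Tendsto (fun n : ℕ => (r ^ 2) ^ (n + 1) * f 0 + (f 1 - r ^ 2 * f 0)) atTop
      (nhds (0 * f 0 + (f 1 - r ^ 2 * f 0))) := by
    refine Tendsto.add_const _ (Tendsto.mul_const _ ?_)
    exact (tendsto_add_atTop_iff_nat 1).2
      (tendsto_pow_atTop_nhds_zero_of_lt_one (sq_nonneg r) (by nlinarith))
  have := ge_of_tendsto' ht (fun n => (hf (n + 1)).trans (h2 n))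
  linarith

lemma aux_defect {H : Type*} [NormedAddCommGroup H] [InnerProductSpace ℂ H] [CompleteSpace H]
    (r : ℝ) (T D : H →L[ℂ] H)
    (hDpos : D.IsPositive) (hDsq : D * D = alphaOp r T) (y : H) :
    ‖D y‖ ^ 2 = (1 + r ^ 2) * ‖T y‖ ^ 2 - ‖T (T y)‖ ^ 2 - r ^ 2 * ‖y‖ ^ 2 := by
  have hs : adjoint D = D := hDpos.isSelfAdjoint.adjoint_eq
  have h1 : inner ℂ (D y) (D y) = inner ℂ y ((D * D) y) := by
    conv_lhs => rw [← ContinuousLinearMap.adjoint_inner_right, hs]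
    rfl
  rw [hDsq] at h1
  have h2 : inner ℂ y (alphaOp r T y) =
      -inner ℂ (T (T y)) (T (T y)) + ((1 + r ^ 2 : ℝ) : ℂ) * inner ℂ (T y) (T y)
        - ((r ^ 2 : ℝ) : ℂ) * inner ℂ y y := by
    simp only [alphaOp, pow_two, ContinuousLinearMap.add_apply, ContinuousLinearMap.sub_apply,
      ContinuousLinearMap.neg_apply, ContinuousLinearMap.smul_apply,
      ContinuousLinearMap.mul_apply, ContinuousLinearMap.one_apply, inner_add_right,
      inner_sub_right, inner_neg_right, inner_smul_right,
      ContinuousLinearMap.adjoint_inner_right]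
  rw [h2] at h1
  simp only [inner_self_eq_norm_sq_to_K] at h1
  have h3 : ((‖D y‖ ^ 2 : ℝ) : ℂ) =
    ((-‖T (T y)‖ ^ 2 + (1 + r ^ 2) * ‖T y‖ ^ 2 - r ^ 2 * ‖y‖ ^ 2 : ℝ) : ℂ) := by
    push_cast
    simpa using h1
  have h4 := Complex.ofReal_injective h3
  linarith

/-- if `T ∈ C_α` (invertible with inverse `S` and `α(T*,T) ≥ 0`) with defect
operator `D`, then for every `x` the series `∑_{n≥1} r^{2n-2}‖DT^{-n}x‖²` converges and
equals `-‖Tx‖² + ‖x‖² + (r²-1)·L⁻(T,x)`, where `L⁻(T,x) = lim ‖rⁿT⁻ⁿx‖²`.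
(The series is indexed by `n : ℕ`, the term of index `n` being `r^{2n}‖DT^{-(n+1)}x‖²`,
since `r^{2(n+1)-2} = r^{2n}`.) -/
theorem stmt5 {H : Type*} [NormedAddCommGroup H] [InnerProductSpace ℂ H] [CompleteSpace H]
    (r : ℝ) (hr0 : 0 < r) (hr1 : r < 1)
    (T S D : H →L[ℂ] H) (hTS : T * S = 1) (hST : S * T = 1)
    (hDpos : D.IsPositive) (hDsq : D * D = alphaOp r T) :
    ∀ x : H, ∃ L : ℝ,
      Tendsto (fun n : ℕ => ‖(r ^ n : ℝ) • ((S ^ n) x)‖ ^ 2) atTop (nhds L) ∧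
      HasSum (fun n : ℕ => r ^ (2 * n) * ‖D ((S ^ (n + 1)) x)‖ ^ 2)
        (-‖T x‖ ^ 2 + ‖x‖ ^ 2 + (r ^ 2 - 1) * L) := by
  intro x
  have hd := aux_defect r T D hDpos hDsq
  have hTSa : ∀ y, T (S y) = y := fun y => by
    have := congrArg (fun A : H →L[ℂ] H => A y) hTS
    simpa using this
  have hS : ∀ n, (S ^ (n + 1)) x = S ((S ^ n) x) := fun n => by
    rw [pow_succ']; rfl
  have key : ∀ y, r ^ 2 * ‖y‖ ^ 2 ≤ ‖T y‖ ^ 2 := by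
    intro y
    have := aux_real r hr0 hr1 (fun n => ‖(T ^ n) y‖ ^ 2) (fun n => sq_nonneg _) (by
      intro n
      have e1 : (T ^ (n + 1)) y = T ((T ^ n) y) := by rw [pow_succ']; rfl
      have e2 : (T ^ (n + 2)) y = T (T ((T ^ n) y)) := by
        rw [pow_succ', pow_succ']; rfl
      simp only [e1, e2]
      rw [← hd]
      exact sq_nonneg _)
    simpa using this
  have hb : ∀ n : ℕ, ‖(r ^ n : ℝ) • ((S ^ n) x)‖ ^ 2 = r ^ (2 * n) * ‖(S ^ n) x‖ ^ 2 := by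
    intro n
    rw [norm_smul, mul_pow, Real.norm_eq_abs, sq_abs, ← pow_mul, mul_comm n 2]
  have hanti : Antitone (fun n : ℕ => ‖(r ^ n : ℝ) • ((S ^ n) x)‖ ^ 2) := by
    refine antitone_nat_of_succ_le fun n => ?_
    rw [hb, hb, hS]
    have := key (S ((S ^ n) x))
    rw [hTSa] at this
    have h2 := mul_le_mul_of_nonneg_left this (pow_nonneg hr0.le (2 * n))
    calc _ = r ^ (2 * n) * (r ^ 2 * ‖S ((S ^ n) x)‖ ^ 2) := by ring
      _ ≤ _ := h2
  have hlim := tendsto_atTop_ciInf hanti ⟨0, by rintro _ ⟨n, rfl⟩; positivity⟩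
  refine ⟨_, hlim, ?_⟩
  generalize (⨅ n : ℕ, ‖(r ^ n : ℝ) • ((S ^ n) x)‖ ^ 2) = L at hlim
  rw [hasSum_iff_tendsto_nat_of_nonneg
    (fun n => mul_nonneg (pow_nonneg hr0.le _) (sq_nonneg _))]
  have hsum : ∀ N : ℕ, ∑ n ∈ Finset.range N, r ^ (2 * n) * ‖D ((S ^ (n + 1)) x)‖ ^ 2 =
      ‖x‖ ^ 2 - ‖T x‖ ^ 2 - r ^ (2 * N) * ‖(S ^ N) x‖ ^ 2
        + r ^ (2 * N) * ‖T ((S ^ N) x)‖ ^ 2 := by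
    intro N
    induction N with
    | zero => simp
    | succ k ih =>
      rw [Finset.sum_range_succ, ih, hd, hS, hTSa]
      ring
  rw [← tendsto_add_atTop_iff_nat 1]
  have h1 := (tendsto_add_atTop_iff_nat 1).2 hlim
  have h2 := (h1.const_sub (‖x‖ ^ 2 - ‖T x‖ ^ 2)).add (hlim.const_mul (r ^ 2))
  have e : -‖T x‖ ^ 2 + ‖x‖ ^ 2 + (r ^ 2 - 1) * L =
    ‖x‖ ^ 2 - ‖T x‖ ^ 2 - L + r ^ 2 * L := by ring
  rw [e]
  refine h2.congr fun n => ?_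
  rw [hsum, hb, hb, hS, hTSa]
  ring
end

section
/- Let 0<r<1, let H₁ and H₂ be complex Hilbert spaces with unitary operators U₁ on H₁ and U₂ on H₂, and let N := U₁ ⊕ rU₂ act on the Hilbert space direct sum H₁ ⊕ H₂ (so N(x₁,x₂) = (U₁x₁, rU₂x₂)). Then N is invertible and α(N*,N) = 0; equivalently, (1+r²)‖Nx‖² − ‖N²x‖² − r²‖x‖² = 0 for every x ∈ H₁ ⊕ H₂. -/
open ContinuousLinearMap

/-- if `U₁`, `U₂` are unitary and `N = U₁ ⊕ rU₂` on the Hilbert direct sum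
`H₁ ⊕ H₂` (realized as `WithLp 2 (H₁ × H₂)`), then `N` is invertible, `α(N*,N) = 0`, and
`(1+r²)‖Nx‖² - ‖N²x‖² - r²‖x‖² = 0` for every `x`. -/
theorem stmt9 {H₁ H₂ : Type*}
    [NormedAddCommGroup H₁] [InnerProductSpace ℂ H₁] [CompleteSpace H₁]
    [NormedAddCommGroup H₂] [InnerProductSpace ℂ H₂] [CompleteSpace H₂]
    (r : ℝ) (hr0 : 0 < r) (hr1 : r < 1)
    (U₁ : H₁ →L[ℂ] H₁) (U₂ : H₂ →L[ℂ] H₂)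
    (hU₁ : U₁ ∈ unitary (H₁ →L[ℂ] H₁)) (hU₂ : U₂ ∈ unitary (H₂ →L[ℂ] H₂))
    (N : WithLp 2 (H₁ × H₂) →L[ℂ] WithLp 2 (H₁ × H₂))
    (hN : ∀ x : WithLp 2 (H₁ × H₂),
      N x = (WithLp.equiv 2 (H₁ × H₂)).symm
        (U₁ (WithLp.equiv 2 (H₁ × H₂) x).1, (r : ℂ) • U₂ (WithLp.equiv 2 (H₁ × H₂) x).2)) :
    IsUnit N ∧ alphaOp r N = 0 ∧
      ∀ x : WithLp 2 (H₁ × H₂),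
        (1 + r ^ 2) * ‖N x‖ ^ 2 - ‖N (N x)‖ ^ 2 - r ^ 2 * ‖x‖ ^ 2 = 0 := by
  have i1 : ∀ x y, inner ℂ (U₁ x) (U₁ y) = inner ℂ x y := fun x y => by
    rw [← ContinuousLinearMap.adjoint_inner_right, ← ContinuousLinearMap.mul_apply,
      ← ContinuousLinearMap.star_eq_adjoint, hU₁.1, ContinuousLinearMap.one_apply]
  have i2 : ∀ x y, inner ℂ (U₂ x) (U₂ y) = inner ℂ x y := fun x y => by
    rw [← ContinuousLinearMap.adjoint_inner_right, ← ContinuousLinearMap.mul_apply,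
      ← ContinuousLinearMap.star_eq_adjoint, hU₂.1, ContinuousLinearMap.one_apply]
  have iN : ∀ x y, inner ℂ (N x) (N y)
      = inner ℂ x.fst y.fst + (r : ℂ) ^ 2 * inner ℂ x.snd y.snd := fun x y => by
    rw [hN, hN]
    simp [-Complex.coe_smul, -Complex.real_smul, WithLp.prod_inner_apply, i1, i2, inner_smul_left, inner_smul_right]
    ring
  have iNN : ∀ x y, inner ℂ (N (N x)) (N (N y))
      = inner ℂ x.fst y.fst + (r : ℂ) ^ 4 * inner ℂ x.snd y.snd := fun x y => by
    rw [iN, hN x, hN y]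
    simp [i1, i2, inner_smul_left, inner_smul_right]
    ring
  have key : ∀ x y, (1 + (r : ℂ) ^ 2) * inner ℂ (N x) (N y) - inner ℂ (N (N x)) (N (N y))
      - (r : ℂ) ^ 2 * inner ℂ x y = 0 := fun x y => by
    rw [iN, iNN, WithLp.prod_inner_apply]
    simp only [WithLp.ofLp_fst, WithLp.ofLp_snd]
    ring
  have hr : (r : ℂ) ≠ 0 := by exact_mod_cast hr0.ne'
  refine ⟨?_, ?_, ?_⟩
  · have b1 : Function.Bijective U₁ := ContinuousLinearMap.isUnit_iff_bijective.1
      ⟨Unitary.toUnits ⟨U₁, hU₁⟩, rfl⟩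
    have b2 : Function.Bijective U₂ := ContinuousLinearMap.isUnit_iff_bijective.1
      ⟨Unitary.toUnits ⟨U₂, hU₂⟩, rfl⟩
    rw [ContinuousLinearMap.isUnit_iff_bijective]
    constructor
    · intro x y h
      rw [hN, hN, Equiv.apply_eq_iff_eq, Prod.mk.injEq] at h
      apply (WithLp.equiv 2 (H₁ × H₂)).injective
      exact Prod.ext (b1.1 h.1) (b2.1 (smul_right_injective _ hr h.2))
    · intro y
      obtain ⟨a, ha⟩ := b1.2 (WithLp.equiv 2 (H₁ × H₂) y).1
      obtain ⟨b, hb⟩ := b2.2 ((r : ℂ)⁻¹ • (WithLp.equiv 2 (H₁ × H₂) y).2)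
      refine ⟨(WithLp.equiv 2 (H₁ × H₂)).symm (a, b), ?_⟩
      rw [hN, Equiv.apply_symm_apply, ha, hb, smul_inv_smul₀ hr]
      rfl
  · ext1 x
    refine ext_inner_right ℂ fun y => ?_
    have := key x y
    simp only [alphaOp, pow_two, ContinuousLinearMap.sub_apply, ContinuousLinearMap.add_apply,
      ContinuousLinearMap.neg_apply, ContinuousLinearMap.smul_apply,
      ContinuousLinearMap.mul_apply, ContinuousLinearMap.one_apply, inner_sub_left,
      inner_add_left, inner_neg_left, inner_smul_left, ContinuousLinearMap.adjoint_inner_left,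
      ContinuousLinearMap.zero_apply, inner_zero_left, Complex.conj_ofReal]
    push_cast
    linear_combination this
  · intro x
    have := key x x
    have e : ∀ z : WithLp 2 (H₁ × H₂), inner ℂ z z = ((‖z‖ : ℝ) : ℂ) ^ 2 :=
      fun z => inner_self_eq_norm_sq_to_K z
    simp only [e] at this
    exact_mod_cast this
end

section
/- Let 0<r<1, let E be a complex Hilbert space, and define weights w : ℤ → ℝ by w_n = r^{2n} for n ≥ 0 and w_n = 1 for n ≤ −1. For a sequence f : ℤ → E with ∑_{n∈ℤ} w_n‖f_n‖² < ∞, let (Sf)_n := f_{n−1}. Then the families n ↦ w_n‖(Sf)_n‖² and n ↦ w_n‖(S²f)_n‖² are summable, and (1+r²)∑_{n} w_n‖(Sf)_n‖² − ∑_{n} w_n‖(S²f)_n‖² − r²∑_{n} w_n‖f_n‖² = (1−r²)‖f_{−1}‖² ≥ 0. Moreover, ∑_{n} w_n‖f_{n+1}‖² ≤ r^{−2} ∑_{n} w_n‖f_n‖², so that S is a bounded invertible operator on the corresponding weighted ℓ² space. (This says that the model operator M_z^t on H²_r(𝔹,E), realized as this weighted bilateral shift, belongs to the class C_α.) -/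
/-- the model operator `M_z^t` on `H²_r(𝔹,E)`, realized as the bilateral
forward shift `(Sf)_n = f_{n-1}` on the weighted `ℓ²` space with weights `w_n = r^{2n}`
for `n ≥ 0` and `w_n = 1` for `n ≤ -1`, belongs to the class `C_α`: for every `f` in the
space, the shifted families are summable,
`(1+r²)∑ w_n‖(Sf)_n‖² - ∑ w_n‖(S²f)_n‖² - r²∑ w_n‖f_n‖² = (1-r²)‖f_{-1}‖² ≥ 0`,
and `∑ w_n‖f_{n+1}‖² ≤ r⁻²∑ w_n‖f_n‖²` (boundedness of the inverse shift). -/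
theorem stmt10 {E : Type*} [NormedAddCommGroup E] [InnerProductSpace ℂ E] [CompleteSpace E]
    (r : ℝ) (hr0 : 0 < r) (hr1 : r < 1)
    (w : ℤ → ℝ) (hw : ∀ n : ℤ, w n = if 0 ≤ n then r ^ (2 * n) else 1)
    (f : ℤ → E) (hf : Summable fun n : ℤ => w n * ‖f n‖ ^ 2) :
    Summable (fun n : ℤ => w n * ‖f (n - 1)‖ ^ 2) ∧
    Summable (fun n : ℤ => w n * ‖f (n - 2)‖ ^ 2) ∧
    (1 + r ^ 2) * (∑' n : ℤ, w n * ‖f (n - 1)‖ ^ 2) - (∑' n : ℤ, w n * ‖f (n - 2)‖ ^ 2)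
        - r ^ 2 * (∑' n : ℤ, w n * ‖f n‖ ^ 2) = (1 - r ^ 2) * ‖f (-1)‖ ^ 2 ∧
    0 ≤ (1 - r ^ 2) * ‖f (-1)‖ ^ 2 ∧
    Summable (fun n : ℤ => w n * ‖f (n + 1)‖ ^ 2) ∧
    (∑' n : ℤ, w n * ‖f (n + 1)‖ ^ 2) ≤ r⁻¹ ^ 2 * ∑' n : ℤ, w n * ‖f n‖ ^ 2 := by
  have h1 : ∀ n : ℤ, 0 ≤ n → w (n + 1) = r ^ 2 * w n := by
    intro n hn
    rw [hw, hw, if_pos hn, if_pos (by omega), show 2 * (n + 1) = 2 + 2 * n by ring,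
      zpow_add₀ hr0.ne']
    norm_cast
  have h2 : ∀ n : ℤ, n ≤ 0 → w n = 1 := by
    intro n hn
    rw [hw]
    split_ifs with h
    · have : n = 0 := by omega
      subst this
      simp
    · rfl
  have hr2 : r ^ 2 < 1 := by nlinarith
  have hr2' : 0 < r ^ 2 := by positivity
  have hpos : ∀ n, 0 ≤ w n := by
    intro n
    rw [hw]
    split_ifs
    · positivity
    · exact zero_le_one
  have hle : ∀ n, w (n + 1) ≤ w n := by
    intro n
    rcases le_or_gt 0 n with h | h
    · rw [h1 n h]
      nlinarith [hpos n]
    · rw [h2 _ (by omega : n + 1 ≤ 0), h2 _ h.le]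
  have hge : ∀ n, r ^ 2 * w n ≤ w (n + 1) := by
    intro n
    rcases le_or_gt 0 n with h | h
    · rw [h1 n h]
    · rw [h2 _ (by omega : n + 1 ≤ 0), h2 _ h.le]
      linarith
  have s1 : Summable (fun n : ℤ => w (n + 1) * ‖f n‖ ^ 2) :=
    Summable.of_nonneg_of_le (fun n => mul_nonneg (hpos _) (sq_nonneg _))
      (fun n => mul_le_mul_of_nonneg_right (hle n) (sq_nonneg _)) hf
  have s2 : Summable (fun n : ℤ => w (n + 2) * ‖f n‖ ^ 2) := by
    refine Summable.of_nonneg_of_le (fun n => mul_nonneg (hpos _) (sq_nonneg _))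
      (fun n => mul_le_mul_of_nonneg_right ?_ (sq_nonneg _)) s1
    have := hle (n + 1)
    rwa [show n + 1 + 1 = n + 2 by ring] at this
  have hb : ∀ n, w (n - 1) * ‖f n‖ ^ 2 ≤ r⁻¹ ^ 2 * (w n * ‖f n‖ ^ 2) := by
    intro n
    rw [← mul_assoc]
    refine mul_le_mul_of_nonneg_right ?_ (sq_nonneg _)
    have := hge (n - 1)
    rw [sub_add_cancel] at this
    rw [inv_pow, inv_mul_eq_div, le_div_iff₀ hr2']
    linarith
  have s3 : Summable (fun n : ℤ => w (n - 1) * ‖f n‖ ^ 2) :=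
    Summable.of_nonneg_of_le (fun n => mul_nonneg (hpos _) (sq_nonneg _)) hb (hf.mul_left _)
  have t1 : HasSum (fun n : ℤ => w n * ‖f (n - 1)‖ ^ 2) (∑' n : ℤ, w (n + 1) * ‖f n‖ ^ 2) := by
    rw [← (Equiv.addRight (1 : ℤ)).hasSum_iff]
    convert s1.hasSum using 2 with n
    simp
  have t2 : HasSum (fun n : ℤ => w n * ‖f (n - 2)‖ ^ 2) (∑' n : ℤ, w (n + 2) * ‖f n‖ ^ 2) := by
    rw [← (Equiv.addRight (2 : ℤ)).hasSum_iff]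
    convert s2.hasSum using 2 with n
    simp
  have t3 : HasSum (fun n : ℤ => w n * ‖f (n + 1)‖ ^ 2) (∑' n : ℤ, w (n - 1) * ‖f n‖ ^ 2) := by
    rw [← (Equiv.subRight (1 : ℤ)).hasSum_iff]
    convert s3.hasSum using 2 with n
    simp
  refine ⟨t1.summable, t2.summable, ?_, mul_nonneg (by linarith) (sq_nonneg _), t3.summable, ?_⟩
  · rw [t1.tsum_eq, t2.tsum_eq]
    have key := ((s1.hasSum.mul_left (1 + r ^ 2)).sub s2.hasSum).sub (hf.hasSum.mul_left (r ^ 2))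
    have hs := hasSum_single (f := fun n : ℤ => (1 + r ^ 2) * (w (n + 1) * ‖f n‖ ^ 2)
      - w (n + 2) * ‖f n‖ ^ 2 - r ^ 2 * (w n * ‖f n‖ ^ 2)) (-1) ?_
    · refine (key.unique hs).trans ?_
      have e0 := h2 (-1 + 1) (by norm_num)
      have e1 := h2 (-1) (by norm_num)
      have e2 : w (-1 + 2) = r ^ 2 := by
        have := h1 0 le_rfl
        rw [h2 0 le_rfl] at this
        simpa using this
      simp only [e0, e1, e2]
      ring
    · intro n hn
      rcases le_or_gt 0 n with h | h
      · have e2 := h1 (n + 1) (by omega)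
        rw [show n + 1 + 1 = n + 2 by ring] at e2
        simp only [e2, h1 n h]
        ring
      · simp only [h2 n h.le, h2 (n + 1) (by omega), h2 (n + 2) (by omega)]
        ring
  · rw [t3.tsum_eq, ← tsum_mul_left]
    exact s3.tsum_le_tsum hb (hf.mul_left _)
end

section
/- Let 0<r<1, a>0, let E be a complex Hilbert space, and define weights ω : ℤ → ℝ by ω_n = (1 + a²r^{−2n−2})^{−1}. For every sequence f : ℤ → E with ∑_{n∈ℤ} ω_n‖f_n‖² < ∞, letting (Sf)_n := f_{n−1}, the families n ↦ ω_n‖(Sf)_n‖² and n ↦ ω_n‖(S²f)_n‖² are summable and (1+r²)∑_{n} ω_n‖(Sf)_n‖² − ∑_{n} ω_n‖(S²f)_n‖² − r²∑_{n} ω_n‖f_n‖² ≥ 0. (This says that the operator M_z^t on H²(𝔹,E,a), realized as this weighted bilateral shift, belongs to the class C_α.) -/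
/-- the operator `M_z^t` on `H²(𝔹,E,a)`, realized as the bilateral forward
shift `(Sf)_n = f_{n-1}` on the weighted `ℓ²` space with weights
`ω_n = (1 + a²r^{-2n-2})⁻¹`, belongs to the class `C_α`: for every `f` in the space, the
shifted families are summable and
`(1+r²)∑ ω_n‖(Sf)_n‖² - ∑ ω_n‖(S²f)_n‖² - r²∑ ω_n‖f_n‖² ≥ 0`. -/
theorem stmt11 {E : Type*} [NormedAddCommGroup E] [InnerProductSpace ℂ E] [CompleteSpace E]
    (r a : ℝ) (hr0 : 0 < r) (hr1 : r < 1) (ha : 0 < a)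
    (ω : ℤ → ℝ) (hω : ∀ n : ℤ, ω n = (1 + a ^ 2 * r ^ (-2 * n - 2))⁻¹)
    (f : ℤ → E) (hf : Summable fun n : ℤ => ω n * ‖f n‖ ^ 2) :
    Summable (fun n : ℤ => ω n * ‖f (n - 1)‖ ^ 2) ∧
    Summable (fun n : ℤ => ω n * ‖f (n - 2)‖ ^ 2) ∧
    0 ≤ (1 + r ^ 2) * (∑' n : ℤ, ω n * ‖f (n - 1)‖ ^ 2)
        - (∑' n : ℤ, ω n * ‖f (n - 2)‖ ^ 2) - r ^ 2 * (∑' n : ℤ, ω n * ‖f n‖ ^ 2) := by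
  have hx : ∀ n : ℤ, ∃ y : ℝ, 0 < y ∧ ω n = (1 + r ^ 4 * y)⁻¹ ∧ ω (n + 1) = (1 + r ^ 2 * y)⁻¹ ∧
      ω (n + 2) = (1 + y)⁻¹ := by
    intro n
    have h2 : r ^ (-2 * n - 2) = r ^ 4 * r ^ (-2 * (n + 2) - 2) := by
      rw [← zpow_natCast, ← zpow_add₀ hr0.ne']; congr 1; push_cast; ring
    have h1 : r ^ (-2 * (n + 1) - 2) = r ^ 2 * r ^ (-2 * (n + 2) - 2) := by
      rw [← zpow_natCast, ← zpow_add₀ hr0.ne']; congr 1; push_cast; ring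
    refine ⟨a ^ 2 * r ^ (-2 * (n + 2) - 2), by positivity, ?_, ?_, hω _⟩
    · rw [hω, h2]; congr 2; ring
    · rw [hω, h1]; congr 2; ring
  have hq : r ^ 2 < 1 := by nlinarith
  have hpos : ∀ n, 0 ≤ ω n := by
    intro n; rw [hω]; positivity
  have hanti : ∀ n, ω (n + 1) ≤ ω n := by
    intro n
    obtain ⟨y, hy, h0, h1, h2⟩ := hx n
    rw [h0, h1]
    apply inv_anti₀ (by positivity)
    have : 0 < r ^ 2 * y := by positivity
    nlinarith
  have hkey : ∀ n, 0 ≤ (1 + r ^ 2) * ω (n + 1) - ω (n + 2) - r ^ 2 * ω n := by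
    intro n
    obtain ⟨y, hy, h0, h1, h2⟩ := hx n
    have e : (1 + r ^ 2) * ω (n + 1) - ω (n + 2) - r ^ 2 * ω n =
        y * (1 - r ^ 2) * (1 - r ^ 2) * (1 + r ^ 2) /
          ((1 + r ^ 2 * y) * (1 + y) * (1 + r ^ 4 * y)) := by
      rw [h0, h1, h2]
      have : 1 + r ^ 2 * y ≠ 0 := by positivity
      have : 1 + y ≠ 0 := by positivity
      have : 1 + r ^ 4 * y ≠ 0 := by positivity
      field_simp
      ring
    rw [e]
    have : 0 < 1 - r ^ 2 := by linarith
    positivity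
  have s1 : Summable (fun n : ℤ => ω (n + 1) * ‖f n‖ ^ 2) :=
    Summable.of_nonneg_of_le (fun n => mul_nonneg (hpos _) (by positivity))
      (fun n => mul_le_mul_of_nonneg_right (hanti n) (by positivity)) hf
  have s2 : Summable (fun n : ℤ => ω (n + 2) * ‖f n‖ ^ 2) := by
    refine Summable.of_nonneg_of_le (fun n => mul_nonneg (hpos _) (by positivity))
      (fun n => mul_le_mul_of_nonneg_right ?_ (by positivity)) s1
    have := hanti (n + 1)
    rwa [add_assoc] at this
  have e1 : (fun n : ℤ => ω n * ‖f (n - 1)‖ ^ 2) =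
      (fun n : ℤ => ω (n + 1) * ‖f n‖ ^ 2) ∘ (Equiv.subRight (1 : ℤ)) := by
    ext n; simp
  have e2 : (fun n : ℤ => ω n * ‖f (n - 2)‖ ^ 2) =
      (fun n : ℤ => ω (n + 2) * ‖f n‖ ^ 2) ∘ (Equiv.subRight (2 : ℤ)) := by
    ext n; simp
  have t1 : ∑' n : ℤ, ω n * ‖f (n - 1)‖ ^ 2 = ∑' n : ℤ, ω (n + 1) * ‖f n‖ ^ 2 := by
    rw [e1]; exact Equiv.tsum_eq (Equiv.subRight (1 : ℤ)) (fun n : ℤ => ω (n + 1) * ‖f n‖ ^ 2)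
  have t2 : ∑' n : ℤ, ω n * ‖f (n - 2)‖ ^ 2 = ∑' n : ℤ, ω (n + 2) * ‖f n‖ ^ 2 := by
    rw [e2]; exact Equiv.tsum_eq (Equiv.subRight (2 : ℤ)) (fun n : ℤ => ω (n + 2) * ‖f n‖ ^ 2)
  refine ⟨?_, ?_, ?_⟩
  · rw [e1]; exact (Equiv.summable_iff _).2 s1
  · rw [e2]; exact (Equiv.summable_iff _).2 s2
  · rw [t1, t2, ← tsum_mul_left, ← tsum_mul_left, ← (s1.mul_left _).tsum_sub s2,
      ← ((s1.mul_left _).sub s2).tsum_sub (hf.mul_left _)]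
    apply tsum_nonneg
    intro n
    have := mul_nonneg (hkey n) (sq_nonneg ‖f n‖)
    linarith
end

section
/- Let 0<r<1 and let T be a bounded linear operator on a complex Hilbert space H belonging to the class C_α. Then for every Laurent polynomial p(z) = ∑_{k∈ℤ} c_k z^k (finitely many nonzero complex coefficients c_k), the operator p(T) := ∑_{k∈ℤ} c_k T^k (where negative powers are powers of T⁻¹) satisfies ‖p(T)‖ ≤ √2 · sup{ |p(z)| : z ∈ ℂ, r ≤ |z| ≤ 1 }. -/
open ContinuousLinearMap

section helpers
variable {H : Type*} [NormedAddCommGroup H] [InnerProductSpace ℂ H]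

lemma exp_int_aux (k : ℤ) : ∫ θ in (0:ℝ)..(2*Real.pi), Complex.exp (θ * Complex.I) ^ k =
    if k = 0 then (2 * Real.pi : ℂ) else 0 := by
  split_ifs with h
  · simp [h]
  · have hk : (k * Complex.I : ℂ) ≠ 0 := by simp [h]
    have : ∀ θ : ℝ, Complex.exp (θ * Complex.I) ^ k = Complex.exp ((k * Complex.I) * θ) := by
      intro θ
      rw [← Complex.exp_int_mul]; ring_nf
    simp_rw [this]
    rw [integral_exp_mul_complex hk]
    have h2 : Complex.exp (k * Complex.I * ((2 * Real.pi : ℝ) : ℂ)) = 1 := by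
      have := Complex.exp_int_mul_two_pi_mul_I k
      rw [← this]; congr 1; push_cast; ring
    rw [h2]; simp

lemma parseval_aux (G : Finset ℤ) (y : ℤ → H) :
    ∫ θ in (0:ℝ)..(2*Real.pi), ‖∑ n ∈ G, (Complex.exp (θ * Complex.I) ^ (-n)) • y n‖ ^ 2 =
      2 * Real.pi * ∑ n ∈ G, ‖y n‖ ^ 2 := by
  have key : ∀ θ : ℝ, ((‖∑ n ∈ G, (Complex.exp (θ * Complex.I) ^ (-n)) • y n‖ ^ 2 : ℝ) : ℂ) =
      ∑ n ∈ G, ∑ m ∈ G, Complex.exp (θ * Complex.I) ^ (n - m) * inner ℂ (y n) (y m) := by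
    intro θ
    have h0 := inner_self_eq_norm_sq_to_K (𝕜 := ℂ) (∑ n ∈ G, (Complex.exp (θ * Complex.I) ^ (-n)) • y n)
    have : ((‖∑ n ∈ G, (Complex.exp (θ * Complex.I) ^ (-n)) • y n‖ ^ 2 : ℝ) : ℂ) =
      inner ℂ (∑ n ∈ G, (Complex.exp (θ * Complex.I) ^ (-n)) • y n) (∑ n ∈ G, (Complex.exp (θ * Complex.I) ^ (-n)) • y n) := by
      rw [h0]; push_cast; rfl
    rw [this, sum_inner]
    refine Finset.sum_congr rfl fun n _ => ?_
    rw [inner_sum]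
    refine Finset.sum_congr rfl fun m _ => ?_
    rw [inner_smul_left, inner_smul_right, ← mul_assoc]
    congr 1
    have hne : Complex.exp (θ * Complex.I) ≠ 0 := Complex.exp_ne_zero _
    have hconj : (starRingEnd ℂ) (Complex.exp (θ * Complex.I)) = (Complex.exp (θ * Complex.I))⁻¹ := by
      rw [← Complex.exp_conj, ← Complex.exp_neg]; simp
    rw [map_zpow₀, hconj, sub_eq_add_neg, zpow_add₀ hne, inv_zpow, zpow_neg, inv_inv]
  have hcont : ∀ k : ℤ, Continuous fun θ : ℝ => Complex.exp (θ * Complex.I) ^ k := by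
    intro k
    exact Continuous.zpow₀ (by fun_prop) k (fun θ => Or.inl (Complex.exp_ne_zero _))
  have : (((∫ θ in (0:ℝ)..(2*Real.pi), ‖∑ n ∈ G, (Complex.exp (θ * Complex.I) ^ (-n)) • y n‖ ^ 2) : ℝ) : ℂ) =
      ((2 * Real.pi * ∑ n ∈ G, ‖y n‖ ^ 2 : ℝ) : ℂ) := by
    rw [← intervalIntegral.integral_ofReal]
    simp_rw [key]
    rw [intervalIntegral.integral_finsetSum]
    · push_cast
      rw [Finset.mul_sum]
      refine Finset.sum_congr rfl fun n hn => ?_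
      rw [intervalIntegral.integral_finsetSum]
      · simp_rw [intervalIntegral.integral_mul_const, exp_int_aux]
        rw [Finset.sum_eq_single n]
        · simp [inner_self_eq_norm_sq_to_K]
        · intro m _ hm
          rw [if_neg (by omega)]; simp
        · exact fun h => absurd hn h
      · intro m _
        exact ((hcont _).mul continuous_const).intervalIntegrable _ _
    · intro n _
      refine (continuous_finsetSum _ fun m _ => ?_).intervalIntegrable _ _
      exact (hcont _).mul continuous_const
  exact_mod_cast this

lemma lem1 (s : Finset ℤ) (c : ℤ → ℂ) (M : ℝ)
    (hM : ∀ z : ℂ, ‖z‖ = 1 → ‖∑ k ∈ s, c k * z ^ k‖ ≤ M)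
    (y : ℤ → H) (G : Finset ℤ) (hy : ∀ n, n ∉ G → y n = 0) (F : Finset ℤ) :
    ∑ n ∈ F, ‖∑ k ∈ s, c k • y (n + k)‖ ^ 2 ≤ M ^ 2 * ∑ n ∈ G, ‖y n‖ ^ 2 := by
  classical
  set F' : Finset ℤ := F ∪ (G ×ˢ s).image (fun q => q.1 - q.2) with hF'
  have h1 : ∑ n ∈ F, ‖∑ k ∈ s, c k • y (n + k)‖ ^ 2 ≤ ∑ n ∈ F', ‖∑ k ∈ s, c k • y (n + k)‖ ^ 2 :=
    Finset.sum_le_sum_of_subset_of_nonneg Finset.subset_union_left (fun _ _ _ => by positivity)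
  refine h1.trans ?_
  have hid : ∀ z : ℂ, z ≠ 0 → ∑ n ∈ F', z ^ (-n) • (∑ k ∈ s, c k • y (n + k)) =
      (∑ k ∈ s, c k * z ^ k) • ∑ n ∈ G, z ^ (-n) • y n := by
    intro z hz
    simp_rw [Finset.smul_sum (s := s)]
    rw [Finset.sum_comm, Finset.sum_smul]
    refine Finset.sum_congr rfl fun k hk => ?_
    have e1 : ∑ n ∈ F', z ^ (-n) • c k • y (n + k) = ∑' n : ℤ, z ^ (-n) • c k • y (n + k) := by
      rw [tsum_eq_sum]
      intro n hn
      rw [hy, smul_zero, smul_zero]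
      intro hG
      apply hn
      rw [hF']
      refine Finset.mem_union_right _ (Finset.mem_image.2 ⟨(n + k, k), Finset.mem_product.2 ⟨hG, hk⟩, ?_⟩)
      simp
    have e2 : ∑ n ∈ G, z ^ (-n) • y n = ∑' n : ℤ, z ^ (-n) • y n := by
      rw [tsum_eq_sum]
      intro n hn
      rw [hy n hn, smul_zero]
    rw [e1, e2, ← (Equiv.addRight k).tsum_eq (fun n : ℤ => z ^ (-n) • y n)]
    by_cases hc : c k = 0
    · simp [hc]
    rw [← tsum_const_smul'' ]
    refine tsum_congr fun n => ?_
    simp only [Equiv.coe_addRight, smul_smul]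
    congr 1
    rw [mul_comm, mul_assoc, ← zpow_add₀ hz]
    congr 2; ring
  have hcont : ∀ k : ℤ, Continuous fun θ : ℝ => Complex.exp (θ * Complex.I) ^ k := by
    intro k
    exact Continuous.zpow₀ (by fun_prop) k (fun θ => Or.inl (Complex.exp_ne_zero _))
  have hpi : 0 < 2 * Real.pi := by positivity
  have h2 : 2 * Real.pi * ∑ n ∈ F', ‖∑ k ∈ s, c k • y (n + k)‖ ^ 2 ≤
      2 * Real.pi * (M ^ 2 * ∑ n ∈ G, ‖y n‖ ^ 2) := by
    rw [← parseval_aux, mul_left_comm, ← parseval_aux, ← intervalIntegral.integral_const_mul]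
    apply intervalIntegral.integral_mono_on hpi.le
    · refine Continuous.intervalIntegrable ?_ _ _
      refine (Continuous.norm (continuous_finsetSum _ fun m _ => ?_)).pow 2
      exact (hcont _).smul continuous_const
    · refine Continuous.intervalIntegrable ?_ _ _
      refine continuous_const.mul ((Continuous.norm (continuous_finsetSum _ fun m _ => ?_)).pow 2)
      exact (hcont _).smul continuous_const
    · intro θ _
      rw [hid _ (Complex.exp_ne_zero _), norm_smul, mul_pow]
      gcongr
      exact hM _ (Complex.norm_exp_ofReal_mul_I θ)
  exact le_of_mul_le_mul_left h2 hpi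

lemma lem2 (s : Finset ℤ) (c : ℤ → ℂ) (M : ℝ)
    (hM : ∀ z : ℂ, ‖z‖ = 1 → ‖∑ k ∈ s, c k * z ^ k‖ ≤ M)
    (y : ℤ → H) (B : ℝ) (hy : ∀ G : Finset ℤ, ∑ n ∈ G, ‖y n‖ ^ 2 ≤ B) (F : Finset ℤ) :
    ∑ n ∈ F, ‖∑ k ∈ s, c k • y (n + k)‖ ^ 2 ≤ M ^ 2 * B := by
  classical
  set G : Finset ℤ := (F ×ˢ s).image (fun q => q.1 + q.2) with hG
  have := lem1 s c M hM (fun n => if n ∈ G then y n else 0) G (fun n hn => if_neg hn) F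
  have e : ∑ n ∈ F, ‖∑ k ∈ s, c k • (fun n => if n ∈ G then y n else 0) (n + k)‖ ^ 2 =
      ∑ n ∈ F, ‖∑ k ∈ s, c k • y (n + k)‖ ^ 2 := by
    refine Finset.sum_congr rfl fun n hn => ?_
    congr 2
    refine Finset.sum_congr rfl fun k hk => ?_
    have : n + k ∈ G := Finset.mem_image.2 ⟨(n, k), Finset.mem_product.2 ⟨hn, hk⟩, rfl⟩
    simp [this]
  rw [e] at this
  refine this.trans (mul_le_mul_of_nonneg_left ?_ (sq_nonneg M))
  refine le_trans (le_of_eq ?_) (hy G)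
  exact Finset.sum_congr rfl fun n hn => by simp [hn]

lemma lem2r (ρ : ℝ) (hρ : 0 < ρ) (s : Finset ℤ) (c : ℤ → ℂ) (M : ℝ)
    (hM : ∀ z : ℂ, ‖z‖ = ρ → ‖∑ k ∈ s, c k * z ^ k‖ ≤ M)
    (y : ℤ → H) (B : ℝ) (hy : ∀ G : Finset ℤ, ∑ n ∈ G, (ρ ^ 2) ^ (-n) * ‖y n‖ ^ 2 ≤ B) (F : Finset ℤ) :
    ∑ n ∈ F, (ρ ^ 2) ^ (-n) * ‖∑ k ∈ s, c k • y (n + k)‖ ^ 2 ≤ M ^ 2 * B := by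
  have hρc : (ρ : ℂ) ≠ 0 := by exact_mod_cast hρ.ne'
  have hnorm : ∀ (n : ℤ) (v : H), ‖((ρ : ℂ) ^ (-n)) • v‖ ^ 2 = (ρ ^ 2) ^ (-n) * ‖v‖ ^ 2 := by
    intro n v
    rw [norm_smul, mul_pow, norm_zpow, Complex.norm_real, Real.norm_of_nonneg hρ.le]
    congr 1
    rw [← zpow_natCast, ← zpow_natCast, ← zpow_mul, ← zpow_mul, mul_comm]
  have := lem2 s (fun k => c k * (ρ : ℂ) ^ k) M ?_ (fun n => ((ρ : ℂ) ^ (-n)) • y n) B ?_ F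
  · refine le_trans (le_of_eq ?_) this
    refine Finset.sum_congr rfl fun n _ => ?_
    rw [← hnorm, Finset.smul_sum]
    congr 2
    refine Finset.sum_congr rfl fun k _ => ?_
    rw [smul_smul, smul_smul, mul_assoc, ← zpow_add₀ hρc, mul_comm]
    congr 3; ring
  · intro z hz
    have := hM (ρ * z) (by rw [norm_mul, hz, Complex.norm_real, Real.norm_of_nonneg hρ.le, mul_one])
    refine le_trans (le_of_eq ?_) this
    congr 1
    refine Finset.sum_congr rfl fun k _ => ?_
    rw [mul_zpow, mul_assoc]
  · intro G
    simp_rw [hnorm]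
    exact hy G

lemma lem3 (ρ : ℝ) (hρ : 0 < ρ) (s : Finset ℤ) (c : ℤ → ℂ) (M : ℝ)
    (hM : ∀ z : ℂ, ‖z‖ = ρ → ‖∑ k ∈ s, c k * z ^ k‖ ≤ M)
    (y : ℤ → H) (A C : ℝ) (hC : 0 ≤ C)
    (h : ∀ N : ℕ, ∃ t : ℤ, ∀ n, t ≤ n → n < t + N → (ρ ^ 2) ^ (-n) * ‖y n‖ ^ 2 ≤ C ∧
      A ≤ (ρ ^ 2) ^ (-n) * ‖∑ k ∈ s, c k • y (n + k)‖ ^ 2) : A ≤ M ^ 2 * C := by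
  classical
  obtain ⟨K, hK⟩ : ∃ K : ℕ, ∀ k ∈ s, |k| ≤ K := by
    refine ⟨∑ k ∈ s, k.natAbs, fun k hk => ?_⟩
    have : k.natAbs ≤ ∑ k ∈ s, k.natAbs := Finset.single_le_sum (f := fun k : ℤ => k.natAbs) (fun _ _ => Nat.zero_le _) hk
    rw [Int.abs_eq_natAbs]
    exact_mod_cast this
  have main : ∀ N : ℕ, (N : ℝ) * A ≤ M ^ 2 * ((N + 2 * K) * C) := by
    intro N
    obtain ⟨t, ht⟩ := h (N + 2 * K)
    set y' : ℤ → H := fun n => if n ∈ Finset.Ico t (t + (N + 2 * K : ℕ)) then y n else 0 with hy'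
    have h1 := lem2r ρ hρ s c M hM y' ((N + 2 * K) * C) ?_ (Finset.Ico (t + K) (t + K + N))
    · refine le_trans ?_ h1
      have hcard : (Finset.Ico (t + K) (t + K + N)).card = N := by simp
      have : (N : ℝ) * A = ∑ n ∈ Finset.Ico (t + K) (t + K + N), A := by
        rw [Finset.sum_const, hcard, nsmul_eq_mul]
      rw [this]
      refine Finset.sum_le_sum fun n hn => ?_
      rw [Finset.mem_Ico] at hn
      refine (ht n (by omega) (by push_cast; omega)).2.trans (le_of_eq ?_)
      congr 3
      refine Finset.sum_congr rfl fun k hk => ?_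
      have := abs_le.1 (hK k hk)
      have hmem : n + k ∈ Finset.Ico t (t + (N + 2 * K : ℕ)) := by
        rw [Finset.mem_Ico]; push_cast; omega
      simp only [hy', if_pos hmem]
    · intro G
      have e1 : ∀ n, (ρ ^ 2) ^ (-n) * ‖y' n‖ ^ 2 ≤ if n ∈ Finset.Ico t (t + (N + 2 * K : ℕ)) then C else 0 := by
        intro n
        by_cases hn : n ∈ Finset.Ico t (t + (N + 2 * K : ℕ))
        · simp only [hy', if_pos hn]
          rw [Finset.mem_Ico] at hn
          exact (ht n hn.1 hn.2).1
        · simp only [hy', if_neg hn]; simp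
      refine (Finset.sum_le_sum fun n _ => e1 n).trans ?_
      rw [← Finset.sum_filter, Finset.sum_const, nsmul_eq_mul]
      refine mul_le_mul_of_nonneg_right ?_ hC
      have : (G.filter (fun n => n ∈ Finset.Ico t (t + (N + 2 * K : ℕ)))).card ≤ (Finset.Ico t (t + (N + 2 * K : ℕ))).card :=
        Finset.card_le_card (fun n hn => (Finset.mem_filter.1 hn).2)
      simp only [Int.card_Ico, add_sub_cancel_left, Int.toNat_natCast] at this
      exact_mod_cast this
  by_contra hcon
  push Not at hcon
  obtain ⟨N, hN⟩ := exists_nat_gt (M ^ 2 * (2 * K * C) / (A - M ^ 2 * C))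
  rw [div_lt_iff₀ (by linarith)] at hN
  have := main N
  nlinarith
end helpers

section scalar
open Filter Topology

lemma scal_anti (q : ℝ) (hq0 : 0 < q) (hq1 : q < 1) (u : ℤ → ℝ) (hu : ∀ n, 0 ≤ u n)
    (hd : ∀ n, 0 ≤ (1 + q) * u n - u (n + 1) - q * u (n - 1)) (n : ℤ) : u (n + 1) ≤ u n := by
  by_contra hcon
  push Not at hcon
  set w := u (n + 1) - u n with hw
  have hwpos : 0 < w := by linarith
  have h1 : ∀ j : ℕ, w ≤ u (n - j + 1) - u (n - j) := by
    intro j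
    induction j with
    | zero => simp [hw]
    | succ j ih =>
      have := hd (n - j)
      have e1 : n - ((j + 1 : ℕ) : ℤ) + 1 = n - j := by push_cast; ring
      have e2 : n - ((j + 1 : ℕ) : ℤ) = n - j - 1 := by push_cast; ring
      rw [e1, e2]
      by_contra hc
      push Not at hc
      nlinarith
  have h2 : ∀ j : ℕ, u (n - j + 1) ≤ u (n + 1) - j * w := by
    intro j
    induction j with
    | zero => simp
    | succ j ih =>
      have := h1 j
      have e1 : n - ((j + 1 : ℕ) : ℤ) + 1 = n - j := by push_cast; ring
      rw [e1]; push_cast; linarith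
  obtain ⟨N, hN⟩ := exists_nat_gt (u (n + 1) / w)
  rw [div_lt_iff₀ hwpos] at hN
  have := h2 N
  have := hu (n - N + 1)
  linarith

lemma scal_half (q : ℝ) (u : ℤ → ℝ)
    (hd : ∀ n, 0 ≤ (1 + q) * u n - u (n + 1) - q * u (n - 1)) (a : ℝ)
    (ha : Tendsto (fun n : ℕ => u n) atTop (𝓝 a)) :
    HasSum (fun n : ℕ => (1 + q) * u n - u (n + 1) - q * u (n - 1))
      (u 0 - q * u (-1) - (1 - q) * a) := by
  rw [hasSum_iff_tendsto_nat_of_nonneg (fun n => hd n)]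
  have hs : ∀ N : ℕ, ∑ i ∈ Finset.range N, ((1 + q) * u i - u (i + 1) - q * u (i - 1)) =
      (u 0 - q * u (-1)) - (u N - q * u (N - 1)) := by
    intro N
    induction N with
    | zero => simp
    | succ N ih =>
      rw [Finset.sum_range_succ, ih]; push_cast
      rw [add_sub_cancel_right]; ring
  simp_rw [hs]
  have ha' : Tendsto (fun n : ℕ => u ((n : ℤ) - 1)) atTop (𝓝 a) := by
    rw [← tendsto_add_atTop_iff_nat 1]
    refine ha.congr fun n => ?_
    push_cast; rw [add_sub_cancel_right]
  have := (tendsto_const_nhds (x := u 0 - q * u (-1))).sub (ha.sub (ha'.const_mul q))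
  convert this using 2
  ring

lemma scal (q : ℝ) (hq0 : 0 < q) (hq1 : q < 1) (u : ℤ → ℝ) (hu : ∀ n, 0 ≤ u n)
    (hd : ∀ n, 0 ≤ (1 + q) * u n - u (n + 1) - q * u (n - 1)) :
    Antitone u ∧ (Monotone fun n : ℤ => q ^ (-n) * u n) ∧
    ∃ a b : ℝ, 0 ≤ a ∧ 0 ≤ b ∧ (∀ n, a ≤ u n) ∧ (∀ n, b ≤ q ^ (-n) * u n) ∧
      Tendsto (fun n : ℕ => u n) atTop (𝓝 a) ∧
      Tendsto (fun n : ℕ => q ^ n * u (-n)) atTop (𝓝 b) ∧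
      HasSum (fun n : ℤ => (if 0 ≤ n then 1 else q ^ (-n)) *
        ((1 + q) * u n - u (n + 1) - q * u (n - 1))) ((1 - q) * (u 0 - a - b)) := by
  set u' : ℤ → ℝ := fun n => q ^ n * u (-n) with hu'
  have hu'0 : ∀ n, 0 ≤ u' n := fun n => mul_nonneg (by positivity) (hu _)
  have hde : ∀ n, (1 + q) * u' n - u' (n + 1) - q * u' (n - 1) =
      q ^ n * ((1 + q) * u (-n) - u (-n + 1) - q * u (-n - 1)) := by
    intro n
    simp only [hu']
    have e1 : -(n + 1) = -n - 1 := by ring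
    have e2 : -(n - 1) = -n + 1 := by ring
    rw [e1, e2, zpow_add_one₀ hq0.ne', zpow_sub_one₀ hq0.ne']
    field_simp
    ring
  have hd' : ∀ n, 0 ≤ (1 + q) * u' n - u' (n + 1) - q * u' (n - 1) := by
    intro n
    rw [hde]
    exact mul_nonneg (by positivity) (hd _)
  have A1 : Antitone u := antitone_int_of_succ_le (scal_anti q hq0 hq1 u hu hd)
  have A2 : Antitone u' := antitone_int_of_succ_le (scal_anti q hq0 hq1 u' hu'0 hd')
  have lim : ∀ v : ℤ → ℝ, (∀ n, 0 ≤ v n) → Antitone v →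
      ∃ a, 0 ≤ a ∧ (∀ n, a ≤ v n) ∧ Tendsto (fun n : ℕ => v n) atTop (𝓝 a) := by
    intro v hv hA
    have hA' : Antitone fun n : ℕ => v n := fun m n h => hA (by exact_mod_cast h)
    have hb : BddBelow (Set.range fun n : ℕ => v n) := ⟨0, by rintro _ ⟨n, rfl⟩; exact hv n⟩
    refine ⟨⨅ n : ℕ, v n, le_ciInf fun n => hv n, fun n => ?_, tendsto_atTop_ciInf hA' hb⟩
    exact (ciInf_le hb n.toNat).trans (hA (Int.self_le_toNat n))
  obtain ⟨a, ha0, ha, hat⟩ := lim u hu A1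
  obtain ⟨b, hb0, hb, hbt⟩ := lim u' hu'0 A2
  refine ⟨A1, ?_, a, b, ha0, hb0, ha, ?_, hat, ?_, ?_⟩
  · intro m n hmn
    have := A2 (neg_le_neg hmn)
    simpa [hu'] using this
  · intro n
    have := hb (-n)
    simpa [hu'] using this
  · simpa [hu'] using hbt
  · have s1 := scal_half q u hd a hat
    have s2 := scal_half q u' hd' b hbt
    rw [← hasSum_nat_add_iff' 1] at s2
    have := HasSum.of_nat_of_neg_add_one (f := fun n : ℤ => (if 0 ≤ n then 1 else q ^ (-n)) *
        ((1 + q) * u n - u (n + 1) - q * u (n - 1))) (m := u 0 - q * u (-1) - (1 - q) * a)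
        (m' := u' 0 - q * u' (-1) - (1 - q) * b - ∑ i ∈ Finset.range 1, ((1 + q) * u' i - u' (i + 1) - q * u' (i - 1))) ?_ ?_
    · convert this using 1
      simp [hu']
      field_simp
      ring
    · refine s1.congr_fun ?_ |> fun h => h
      intro n; simp
    · refine s2.congr_fun ?_ |> fun h => h
      intro n
      rw [hde, if_neg (by omega)]
      push_cast
      simp
end scalar

section final
open Filter Topology
variable {H : Type*} [NormedAddCommGroup H] [InnerProductSpace ℂ H] [CompleteSpace H]

lemma exists_D (q : ℝ) (T : H →L[ℂ] H)
    (hpos : ∀ x : H, 0 ≤ (1 + q) * ‖T x‖ ^ 2 - ‖T (T x)‖ ^ 2 - q * ‖x‖ ^ 2) :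
    ∃ D : H →L[ℂ] H, ∀ x, ‖D x‖ ^ 2 = (1 + q) * ‖T x‖ ^ 2 - ‖T (T x)‖ ^ 2 - q * ‖x‖ ^ 2 := by
  set A : H →L[ℂ] H := ((1 + q : ℝ) : ℂ) • (star T * T) - star (T * T) * (T * T) - ((q : ℝ) : ℂ) • 1 with hA
  have hself : ∀ (B : H →L[ℂ] H) (x : H), inner ℂ ((star B * B) x) x = ((‖B x‖ ^ 2 : ℝ) : ℂ) := by
    intro B x
    rw [ContinuousLinearMap.star_eq_adjoint, mul_apply_eq_comp, ContinuousLinearMap.adjoint_inner_left,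
      inner_self_eq_norm_sq_to_K]
    push_cast; rfl
  have hin : ∀ x, inner ℂ (A x) x = (((1 + q) * ‖T x‖ ^ 2 - ‖T (T x)‖ ^ 2 - q * ‖x‖ ^ 2 : ℝ) : ℂ) := by
    intro x
    have h1 := hself T x
    have h2 := hself (T * T) x
    have h3 : inner ℂ x x = ((‖x‖ ^ 2 : ℝ) : ℂ) := by
      rw [inner_self_eq_norm_sq_to_K]; push_cast; rfl
    have : A x = ((1 + q : ℝ) : ℂ) • ((star T * T) x) - (star (T * T) * (T * T)) x - ((q : ℝ) : ℂ) • x := by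
      simp [hA]
    rw [this, inner_sub_left, inner_sub_left, inner_smul_left, inner_smul_left, h1, h2, h3]
    simp
  have hApos : 0 ≤ A := by
    rw [ContinuousLinearMap.nonneg_iff_isPositive, ContinuousLinearMap.isPositive_iff_complex]
    intro x
    rw [hin]
    simp only [RCLike.re_to_complex, Complex.ofReal_re]
    exact ⟨trivial, hpos x⟩
  obtain ⟨D, hD⟩ := CStarAlgebra.nonneg_iff_eq_star_mul_self.1 hApos
  refine ⟨D, fun x => ?_⟩
  have := hself D x
  rw [← hD, hin] at this
  exact_mod_cast this.symm

lemma final_bound (r : ℝ) (hr0 : 0 < r) (hr1 : r < 1) (U : (H →L[ℂ] H)ˣ)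
    (hpos : ∀ x : H, 0 ≤ (1 + r ^ 2) * ‖(U : H →L[ℂ] H) x‖ ^ 2 -
      ‖(U : H →L[ℂ] H) ((U : H →L[ℂ] H) x)‖ ^ 2 - r ^ 2 * ‖x‖ ^ 2)
    (s : Finset ℤ) (c : ℤ → ℂ) (M : ℝ)
    (hM : ∀ z : ℂ, r ≤ ‖z‖ → ‖z‖ ≤ 1 → ‖∑ k ∈ s, c k * z ^ k‖ ≤ M) (x : H) :
    ‖∑ k ∈ s, c k • ((U ^ k : (H →L[ℂ] H)ˣ) : H →L[ℂ] H) x‖ ^ 2 ≤ 2 * M ^ 2 * ‖x‖ ^ 2 := by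
  obtain ⟨D, hD⟩ := exists_D (r ^ 2) (U : H →L[ℂ] H) hpos
  set q := r ^ 2 with hq
  have hq0 : 0 < q := by positivity
  have hq1 : q < 1 := by rw [hq]; nlinarith
  set E : ℤ → H →L[ℂ] H := fun k => ((U ^ k : (H →L[ℂ] H)ˣ) : H →L[ℂ] H) with hE
  have hE0 : ∀ v, E 0 v = v := fun v => by simp [hE]
  have hEadd : ∀ m n v, E (m + n) v = E m (E n v) := fun m n v => by
    simp only [hE, zpow_add, Units.val_mul, mul_apply_eq_comp]
  have hE1 : ∀ v, E 1 v = (U : H →L[ℂ] H) v := fun v => by simp [hE]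
  have hDu : ∀ v n, ‖D (E (n - 1) v)‖ ^ 2 =
      (1 + q) * ‖E n v‖ ^ 2 - ‖E (n + 1) v‖ ^ 2 - q * ‖E (n - 1) v‖ ^ 2 := by
    intro v n
    rw [hD, ← hE1, ← hE1, ← hEadd, ← hEadd]
    congr 6 <;> ring_nf
  have hsc := fun v => scal q hq0 hq1 (fun n => ‖E n v‖ ^ 2) (fun n => by positivity)
    (fun n => by rw [← hDu]; positivity)
  set X := ∑ k ∈ s, c k • E k x with hX
  have hz : ∀ n, ∑ k ∈ s, c k • E (n + k) x = E n X := by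
    intro n
    rw [hX, map_sum]
    exact Finset.sum_congr rfl fun k _ => by rw [hEadd, map_smul]
  have hM1 : ∀ z : ℂ, ‖z‖ = 1 → ‖∑ k ∈ s, c k * z ^ k‖ ≤ M := fun z hz => hM z (by rw [hz]; exact hr1.le) hz.le
  have hMr : ∀ z : ℂ, ‖z‖ = r → ‖∑ k ∈ s, c k * z ^ k‖ ≤ M := fun z hz => hM z hz.ge (by rw [hz]; exact hr1.le)
  obtain ⟨A1, A2, a, b, ha0, hb0, ha, hb, hat, hbt, hsum⟩ := hsc x
  obtain ⟨-, -, a', b', -, -, ha', hb', -, -, hsum'⟩ := hsc X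
  have Ha : a' ≤ M ^ 2 * a := by
    refine ge_of_tendsto' (hat.const_mul (M ^ 2)) fun m => ?_
    refine lem3 1 one_pos s c M hM1 (fun n => E n x) a' _ (by positivity) fun N => ⟨m, fun n h1 h2 => ?_⟩
    simp only [one_pow, one_zpow, one_mul]
    rw [hz]
    exact ⟨A1 h1, ha' n⟩
  have Hb : b' ≤ M ^ 2 * b := by
    refine ge_of_tendsto' (hbt.const_mul (M ^ 2)) fun m => ?_
    refine lem3 r hr0 s c M hMr (fun n => E n x) b' _ (by positivity) fun N => ⟨-m - N, fun n h1 h2 => ?_⟩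
    rw [hz]
    refine ⟨?_, hb' n⟩
    have := A2 (show n ≤ -(m : ℤ) by omega)
    simpa using this
  have Hs : (1 - q) * (‖E 0 X‖ ^ 2 - a' - b') ≤ 2 * M ^ 2 * ((1 - q) * (‖E 0 x‖ ^ 2 - a - b)) := by
    simp_rw [← hDu] at hsum hsum'
    set y : ℤ → H := fun n => D (E (n - 1) x) with hy
    set y1 : ℤ → H := fun n => if 0 ≤ n then y n else 0 with hy1
    set y2 : ℤ → H := fun n => if 0 ≤ n then 0 else y n with hy2
    set f1 : ℤ → ℝ := fun n => ‖y1 n‖ ^ 2 with hf1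
    set f2 : ℤ → ℝ := fun n => q ^ (-n) * ‖y2 n‖ ^ 2 with hf2
    have hf10 : ∀ n, 0 ≤ f1 n := fun n => by positivity
    have hf20 : ∀ n, 0 ≤ f2 n := fun n => by positivity
    have hf : ∀ n, (if 0 ≤ n then 1 else q ^ (-n)) * ‖D (E (n - 1) x)‖ ^ 2 = f1 n + f2 n := by
      intro n
      by_cases h : 0 ≤ n <;> simp [hf1, hf2, hy1, hy2, hy, h]
    simp_rw [hf] at hsum
    have S1 : Summable f1 := Summable.of_nonneg_of_le hf10 (fun n => by linarith [hf20 n]) hsum.summable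
    have S2 : Summable f2 := Summable.of_nonneg_of_le hf20 (fun n => by linarith [hf10 n]) hsum.summable
    rw [← hsum.tsum_eq, S1.tsum_add S2]
    refine hasSum_le_of_sum_le hsum' fun F => ?_
    have L1 := lem2r 1 one_pos s c M hM1 y1 (∑' n, f1 n) (fun G => by
      simpa using S1.sum_le_tsum G (fun n _ => hf10 n)) F
    have L2 := lem2r r hr0 s c M hMr y2 (∑' n, f2 n) (fun G => 
      S2.sum_le_tsum G (fun n _ => hf20 n)) F
    have : ∀ n ∈ F, (if 0 ≤ n then 1 else q ^ (-n)) * ‖D (E (n - 1) X)‖ ^ 2 ≤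
        2 * ((1 ^ 2) ^ (-n) * ‖∑ k ∈ s, c k • y1 (n + k)‖ ^ 2 +
          (r ^ 2) ^ (-n) * ‖∑ k ∈ s, c k • y2 (n + k)‖ ^ 2) := by
      intro n _
      have e : D (E (n - 1) X) = ∑ k ∈ s, c k • y1 (n + k) + ∑ k ∈ s, c k • y2 (n + k) := by
        rw [← hz, map_sum, ← Finset.sum_add_distrib]
        refine Finset.sum_congr rfl fun k _ => ?_
        rw [map_smul, ← smul_add]
        congr 1
        have : y (n + k) = D (E (n - 1 + k) x) := by
          simp only [hy]; congr 2; ring_nf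
        rw [← this]
        by_cases h : 0 ≤ n + k <;> simp [hy1, hy2, h]
      rw [e]
      set p1 := ∑ k ∈ s, c k • y1 (n + k)
      set p2 := ∑ k ∈ s, c k • y2 (n + k)
      have hle : ‖p1 + p2‖ ^ 2 ≤ 2 * (‖p1‖ ^ 2 + ‖p2‖ ^ 2) := by
        have := norm_add_le p1 p2
        nlinarith [norm_nonneg (p1 + p2), sq_nonneg (‖p1‖ - ‖p2‖)]
      have w0 : 0 ≤ (if 0 ≤ n then 1 else q ^ (-n)) := by split_ifs <;> positivity
      have w1 : (if 0 ≤ n then 1 else q ^ (-n)) ≤ 1 := by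
        split_ifs with h
        · exact le_rfl
        · exact zpow_le_one₀ hq0 hq1.le (by omega)
      have w2 : (if 0 ≤ n then 1 else q ^ (-n)) ≤ q ^ (-n) := by
        split_ifs with h
        · exact one_le_zpow_of_nonpos₀ hq0 hq1.le (by omega)
        · exact le_rfl
      have m1 := mul_le_mul_of_nonneg_right w1 (sq_nonneg ‖p1‖)
      have m2 := mul_le_mul_of_nonneg_right w2 (sq_nonneg ‖p2‖)
      have m3 := mul_le_mul_of_nonneg_left hle w0
      rw [one_pow, one_zpow]
      linarith
    refine (Finset.sum_le_sum this).trans ?_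
    rw [← Finset.mul_sum, Finset.sum_add_distrib]
    linarith
  rw [hE0, hE0] at Hs
  have h1q : 0 < 1 - q := by linarith
  have Hs' : ‖X‖ ^ 2 - a' - b' ≤ 2 * M ^ 2 * (‖x‖ ^ 2 - a - b) := by
    refine le_of_mul_le_mul_left ?_ h1q
    linarith
  have := mul_nonneg (sq_nonneg M) ha0
  have := mul_nonneg (sq_nonneg M) hb0
  linarith
end final

theorem stmt14 {H : Type*} [NormedAddCommGroup H] [InnerProductSpace ℂ H] [CompleteSpace H]
    (r : ℝ) (hr0 : 0 < r) (hr1 : r < 1)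
    (T S : H →L[ℂ] H) (hTS : T * S = 1) (hST : S * T = 1)
    (hpos : ∀ x : H, 0 ≤ (1 + r ^ 2) * ‖T x‖ ^ 2 - ‖T (T x)‖ ^ 2 - r ^ 2 * ‖x‖ ^ 2)
    (c : ℤ →₀ ℂ) :
    ‖∑ k ∈ c.support, c k • (if 0 ≤ k then T ^ k.toNat else S ^ (-k).toNat)‖ ≤
      Real.sqrt 2 *
        ⨆ z : {z : ℂ // r ≤ ‖z‖ ∧ ‖z‖ ≤ 1}, ‖∑ k ∈ c.support, c k * (z : ℂ) ^ k‖ := by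
  set M := ⨆ z : {z : ℂ // r ≤ ‖z‖ ∧ ‖z‖ ≤ 1}, ‖∑ k ∈ c.support, c k * (z : ℂ) ^ k‖ with hMdef
  have hM0 : 0 ≤ M := Real.iSup_nonneg fun z => norm_nonneg _
  have hbdd : BddAbove (Set.range fun z : {z : ℂ // r ≤ ‖z‖ ∧ ‖z‖ ≤ 1} =>
      ‖∑ k ∈ c.support, c k * (z : ℂ) ^ k‖) := by
    refine ⟨∑ k ∈ c.support, ‖c k‖ * max 1 (r ^ k), ?_⟩
    rintro _ ⟨⟨z, hz1, hz2⟩, rfl⟩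
    refine (norm_sum_le _ _).trans (Finset.sum_le_sum fun k _ => ?_)
    rw [norm_mul, norm_zpow]
    refine mul_le_mul_of_nonneg_left ?_ (norm_nonneg _)
    have hz0 : 0 < ‖z‖ := hr0.trans_le hz1
    rcases le_total 0 k with h | h
    · exact le_max_of_le_left (zpow_le_one₀ hz0 hz2 h)
    · refine le_max_of_le_right ?_
      obtain ⟨j, rfl⟩ : ∃ j : ℕ, k = -j := ⟨(-k).toNat, by omega⟩
      simp only [zpow_neg, zpow_natCast]
      gcongr
  have hM : ∀ z : ℂ, r ≤ ‖z‖ → ‖z‖ ≤ 1 → ‖∑ k ∈ c.support, c k * z ^ k‖ ≤ M :=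
    fun z h1 h2 => le_ciSup hbdd ⟨z, h1, h2⟩
  let U : (H →L[ℂ] H)ˣ := ⟨T, S, hTS, hST⟩
  have hU : ∀ k : ℤ, (if 0 ≤ k then T ^ k.toNat else S ^ (-k).toNat) =
      ((U ^ k : (H →L[ℂ] H)ˣ) : H →L[ℂ] H) := by
    intro k
    split_ifs with h
    · obtain ⟨j, rfl⟩ : ∃ j : ℕ, k = j := ⟨k.toNat, by omega⟩
      simp [U]
    · obtain ⟨j, rfl⟩ : ∃ j : ℕ, k = -j := ⟨(-k).toNat, by omega⟩
      rw [zpow_neg, zpow_natCast, ← inv_pow, Units.val_pow_eq_pow_val]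
      simp [U]
  refine ContinuousLinearMap.opNorm_le_bound _ (by positivity) fun x => ?_
  have := final_bound r hr0 hr1 U hpos c.support c M hM x
  simp_rw [hU]
  rw [ContinuousLinearMap.sum_apply]
  simp only [ContinuousLinearMap.smul_apply]
  refine le_of_sq_le_sq ?_ (by positivity)
  rw [mul_pow, mul_pow, Real.sq_sqrt (by norm_num)]
  exact this
end

section
/- Let 0<r<1 and 0<s<1, and let H be a nontrivial complex Hilbert space. Then the following are equivalent: (a) s ≤ r; (b) every invertible bounded linear operator T on H satisfying (1+r²)‖Tx‖² − ‖T²x‖² − r²‖x‖² ≥ 0 for all x ∈ H also satisfies (1+s²)‖Tx‖² − ‖T²x‖² − s²‖x‖² ≥ 0 for all x ∈ H. In other words, with α(t)=(1−t)(t−r²) and β(t)=(1−t)(t−s²), the inclusion C_α ⊆ C_β holds if and only if s ≤ r. -/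
/-- for `0<r<1`, `0<s<1` and a nontrivial complex Hilbert space `H`, the
inclusion `C_α ⊆ C_β` (where `α(t)=(1-t)(t-r²)`, `β(t)=(1-t)(t-s²)`) holds if and only
if `s ≤ r`: every invertible `T` with `(1+r²)‖Tx‖² - ‖T²x‖² - r²‖x‖² ≥ 0` for all `x`
also satisfies `(1+s²)‖Tx‖² - ‖T²x‖² - s²‖x‖² ≥ 0` for all `x`, iff `s ≤ r`. -/
theorem stmt15 {H : Type*} [NormedAddCommGroup H] [InnerProductSpace ℂ H] [CompleteSpace H]
    [Nontrivial H]
    (r s : ℝ) (hr0 : 0 < r) (hr1 : r < 1) (hs0 : 0 < s) (hs1 : s < 1) :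
    s ≤ r ↔
      ∀ T : H →L[ℂ] H, IsUnit T →
        (∀ x : H, 0 ≤ (1 + r ^ 2) * ‖T x‖ ^ 2 - ‖T (T x)‖ ^ 2 - r ^ 2 * ‖x‖ ^ 2) →
        (∀ x : H, 0 ≤ (1 + s ^ 2) * ‖T x‖ ^ 2 - ‖T (T x)‖ ^ 2 - s ^ 2 * ‖x‖ ^ 2) := by
  constructor
  · intro hsr T hT hα x
    have hsurj : ∀ y : H, ∃ z : H, T z = y := by
      obtain ⟨u, rfl⟩ := hT
      intro y
      refine ⟨(↑u⁻¹ : H →L[ℂ] H) y, ?_⟩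
      rw [← mul_apply_eq_comp, Units.mul_inv, one_apply_eq_self]
    have hr2 : r ^ 2 < 1 := by nlinarith
    have hcontr : ‖T x‖ ^ 2 ≤ ‖x‖ ^ 2 := by
      by_contra hlt
      push Not at hlt
      have key : ∀ n : ℕ, ∃ y : H, ‖T x‖ ^ 2 - ‖x‖ ^ 2 ≤ ‖T y‖ ^ 2 - ‖y‖ ^ 2 ∧
          ‖y‖ ^ 2 ≤ ‖x‖ ^ 2 - n * (‖T x‖ ^ 2 - ‖x‖ ^ 2) := by
        intro n
        induction n with
        | zero => exact ⟨x, le_refl _, by simp⟩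
        | succ n ih =>
          obtain ⟨y, h1, h2⟩ := ih
          obtain ⟨z, rfl⟩ := hsurj y
          have h3 := hα z
          have h4 : ‖T x‖ ^ 2 - ‖x‖ ^ 2 ≤ ‖T z‖ ^ 2 - ‖z‖ ^ 2 := by
            by_contra h5
            push Not at h5
            have h6 : ‖T x‖ ^ 2 - ‖x‖ ^ 2 ≤ r ^ 2 * (‖T z‖ ^ 2 - ‖z‖ ^ 2) := by linarith
            have h7 := mul_le_mul_of_nonneg_left h5.le (sq_nonneg r)
            have h8 := mul_lt_mul_of_pos_right hr2 (sub_pos.mpr hlt)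
            linarith
          refine ⟨z, h4, ?_⟩
          push_cast
          linarith
      obtain ⟨n, hn⟩ := exists_nat_gt (‖x‖ ^ 2 / (‖T x‖ ^ 2 - ‖x‖ ^ 2))
      rw [div_lt_iff₀ (sub_pos.mpr hlt)] at hn
      obtain ⟨y, -, h2⟩ := key n
      linarith [sq_nonneg ‖y‖]
    have h1 := hα x
    have h2 : s ^ 2 ≤ r ^ 2 := by gcongr
    have h3 := mul_nonneg (sub_nonneg.mpr h2) (sub_nonneg.mpr hcontr)
    linarith
  · intro h
    obtain ⟨x, hx⟩ := exists_ne (0 : H)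
    have hxp : 0 < ‖x‖ ^ 2 := by positivity
    have hc : (r : ℂ) ≠ 0 := by exact_mod_cast hr0.ne'
    have hn : ∀ y : H, ‖((r : ℂ) • (1 : H →L[ℂ] H)) y‖ = r * ‖y‖ := by
      intro y
      simp [norm_smul, abs_of_pos hr0]
    have hu : IsUnit ((r : ℂ) • (1 : H →L[ℂ] H)) :=
      (isUnit_one).smul (Units.mk0 (r : ℂ) hc)
    have h1 := h _ hu (by intro y; rw [hn, hn, hn]; apply le_of_eq; ring) x
    rw [hn, hn, hn] at h1
    have h2 : 0 ≤ (1 - r ^ 2) * (r ^ 2 - s ^ 2) * ‖x‖ ^ 2 := by linarith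
    have h3 := nonneg_of_mul_nonneg_left h2 hxp
    have h4 : 0 ≤ r ^ 2 - s ^ 2 := nonneg_of_mul_nonneg_right h3 (by nlinarith)
    nlinarith
end

section
/- Let 0<r<1 and 0<s<1, let E be a complex Hilbert space, and define weights w : ℤ → ℝ by w_n = 1/(1−r²) for n ≥ 0 and w_n = r^{−2n−2}/(1−r²) for n ≤ −1. For every sequence f : ℤ → E with ∑_{n∈ℤ} w_n‖f_n‖² < ∞, letting (Bf)_n := f_{n+1}, the relevant families are summable and (1+s²)∑_n w_n‖(Bf)_n‖² − ∑_n w_n‖(B²f)_n‖² − s²∑_n w_n‖f_n‖² = ‖f₀‖² + (r²−s²)∑_{n≤−1} r^{−2n−2}‖f_n‖². In particular, if s ≤ r this quantity is nonnegative, so the backward shift B on the weighted space ℓ²_r(E) belongs to the class C_β. -/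
theorem aux_hasSum_congr {u v : ℤ → ℝ} {a : ℝ} (h : ∀ n, u n = v n) (hv : HasSum v a) :
    HasSum u a := by
  rw [show u = v from funext h]
  exact hv

/-- for the backward shift `B` ((Bf)_n = f_{n+1}) on the weighted space
`ℓ²_r(E)` with weights `w_n = 1/(1-r²)` for `n ≥ 0` and `w_n = r^{-2n-2}/(1-r²)` for
`n ≤ -1`, one has
`(1+s²)∑ wₙ‖(Bf)ₙ‖² - ∑ wₙ‖(B²f)ₙ‖² - s²∑ wₙ‖fₙ‖² = ‖f₀‖² + (r²-s²)∑_{n≤-1} r^{-2n-2}‖fₙ‖²`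
for every `f` in the space; in particular if `s ≤ r` this is nonnegative, so `B ∈ C_β`. -/
theorem stmt16 {E : Type*} [NormedAddCommGroup E] [InnerProductSpace ℂ E] [CompleteSpace E]
    (r s : ℝ) (hr0 : 0 < r) (hr1 : r < 1) (hs0 : 0 < s) (hs1 : s < 1)
    (w : ℤ → ℝ)
    (hw : ∀ n : ℤ, w n = if 0 ≤ n then 1 / (1 - r ^ 2) else r ^ (-2 * n - 2) / (1 - r ^ 2))
    (f : ℤ → E) (hf : Summable fun n : ℤ => w n * ‖f n‖ ^ 2) :
    Summable (fun n : ℤ => w n * ‖f (n + 1)‖ ^ 2) ∧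
    Summable (fun n : ℤ => w n * ‖f (n + 2)‖ ^ 2) ∧
    Summable (fun n : ℤ => if n ≤ -1 then r ^ (-2 * n - 2) * ‖f n‖ ^ 2 else 0) ∧
    (1 + s ^ 2) * (∑' n : ℤ, w n * ‖f (n + 1)‖ ^ 2) - (∑' n : ℤ, w n * ‖f (n + 2)‖ ^ 2)
        - s ^ 2 * (∑' n : ℤ, w n * ‖f n‖ ^ 2)
      = ‖f 0‖ ^ 2 +
        (r ^ 2 - s ^ 2) * ∑' n : ℤ, (if n ≤ -1 then r ^ (-2 * n - 2) * ‖f n‖ ^ 2 else 0) ∧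
    (s ≤ r →
      0 ≤ ‖f 0‖ ^ 2 +
        (r ^ 2 - s ^ 2) * ∑' n : ℤ, (if n ≤ -1 then r ^ (-2 * n - 2) * ‖f n‖ ^ 2 else 0)) := by
  have hd : 0 < 1 - r ^ 2 := by nlinarith
  have hd' := hd.ne'
  have hr := hr0.ne'
  have hneg : ∀ n : ℤ, n ≤ -1 → w n = r ^ (-2 * n - 2) / (1 - r ^ 2) := by
    intro n hn
    rw [hw, if_neg (by omega)]
  have hpos : ∀ n : ℤ, -1 ≤ n → w n = 1 / (1 - r ^ 2) := by
    intro n hn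
    rw [hw]
    split_ifs with h
    · rfl
    · obtain rfl : n = -1 := by omega
      norm_num
  have hshift : ∀ n : ℤ, n ≤ -1 → w (n - 1) = r ^ 2 * w n := by
    intro n hn
    rw [hneg n hn, hneg (n - 1) (by omega),
      show -2 * (n - 1) - 2 = (-2 * n - 2) + 2 by ring, zpow_add₀ hr]
    norm_cast
    ring
  set g : ℤ → ℝ := fun n => if n ≤ -1 then r ^ (-2 * n - 2) * ‖f n‖ ^ 2 else 0 with hgdef
  have hg1 : ∀ n : ℤ, n ≤ -1 → g n = (1 - r ^ 2) * (w n * ‖f n‖ ^ 2) := by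
    intro n hn
    simp only [hgdef, if_pos hn, hneg n hn]
    field_simp
  have hg2 : ∀ n : ℤ, ¬ n ≤ -1 → g n = 0 := by
    intro n hn
    simp only [hgdef, if_neg hn]
  have hg0 : ∀ n, 0 ≤ g n := by
    intro n
    simp only [hgdef]
    split_ifs <;> positivity
  have hw0 : ∀ n, 0 ≤ w n := by
    intro n
    rw [hw]
    split_ifs <;> positivity
  have hg : Summable g := by
    refine Summable.of_nonneg_of_le hg0 (fun n => ?_) (hf.mul_left (1 - r ^ 2))
    by_cases hn : n ≤ -1
    · exact (hg1 n hn).le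
    · rw [hg2 n hn]
      exact mul_nonneg hd.le (mul_nonneg (hw0 n) (by positivity))
  have H1 : HasSum (fun n : ℤ => w (n - 1) * ‖f n‖ ^ 2)
      ((∑' n : ℤ, w n * ‖f n‖ ^ 2) - ∑' n, g n) := by
    refine aux_hasSum_congr ?_ (hf.hasSum.sub hg.hasSum)
    intro n
    by_cases hn : n ≤ -1
    · rw [hg1 n hn, hshift n hn]; ring
    · rw [hg2 n hn, hpos n (by omega), hpos (n - 1) (by omega)]; ring
  have H2 : HasSum (fun n : ℤ => w (n - 2) * ‖f n‖ ^ 2)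
      ((∑' n : ℤ, w n * ‖f n‖ ^ 2) - (1 + r ^ 2) * (∑' n, g n) - ‖f 0‖ ^ 2) := by
    refine aux_hasSum_congr ?_ ((hf.hasSum.sub (hg.hasSum.mul_left (1 + r ^ 2))).sub
      (hasSum_ite_eq (0 : ℤ) (‖f 0‖ ^ 2)))
    intro n
    by_cases hn : n ≤ -1
    · rw [hg1 n hn, if_neg (by omega), show n - 2 = n - 1 - 1 by ring,
        hshift (n - 1) (by omega), hshift n hn]; ring
    · rw [hg2 n hn]
      by_cases h0 : n = 0
      · subst h0
        rw [if_pos rfl, show (0 : ℤ) - 2 = -1 - 1 by ring, hshift (-1) le_rfl,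
          hpos (-1) le_rfl, hpos 0 (by omega)]
        field_simp
        ring
      · rw [if_neg h0, hpos n (by omega), hpos (n - 2) (by omega)]; ring
  have K1 := (Equiv.addRight (1 : ℤ)).hasSum_iff.mpr H1
  have K2 := (Equiv.addRight (2 : ℤ)).hasSum_iff.mpr H2
  simp only [Function.comp_def, Equiv.coe_addRight, add_sub_cancel_right] at K1 K2
  refine ⟨K1.summable, K2.summable, hg, ?_, ?_⟩
  · rw [K1.tsum_eq, K2.tsum_eq]; ring
  · intro hsr
    have h1 : 0 ≤ r ^ 2 - s ^ 2 := by nlinarith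
    have h2 : 0 ≤ ∑' n, g n := tsum_nonneg hg0
    positivity
end

section
/- Let 0<r≤1/2 and let T₁ be the operator on ℂ² given by the matrix [[1/√2, 0], [1/2, 1/√2]] (i.e., T₁(x,y) = (x/√2, x/2 + y/√2)). Then T₁ is invertible, ‖T₁v‖ ≤ ‖v‖ and ‖T₁v‖ ≥ (1/2)‖v‖ ≥ r‖v‖ for all v ∈ ℂ² (so ‖T₁‖ ≤ 1 and ‖T₁⁻¹‖ ≤ 1/r), but for e₁ = (1,0) one has (1+r²)‖T₁e₁‖² − ‖T₁²e₁‖² − r²‖e₁‖² = −r²/4 < 0, so T₁ is not in the class C_α. Hence the inclusion C_α ⊆ C_{1,r} is strict for 0<r≤1/2. -/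
lemma normsq_aux (v : EuclideanSpace ℂ (Fin 2)) :
    ‖v‖ ^ 2 = (v 0).re ^ 2 + (v 0).im ^ 2 + ((v 1).re ^ 2 + (v 1).im ^ 2) := by
  rw [EuclideanSpace.norm_sq_eq, Fin.sum_univ_two, Complex.sq_norm, Complex.sq_norm,
    Complex.normSq_apply, Complex.normSq_apply]
  ring

lemma le_of_sq_le_aux {a b : ℝ} (hb : 0 ≤ b) (h : a ^ 2 ≤ b ^ 2) : a ≤ b :=
  abs_le_of_sq_le_sq' h hb |>.2

/-- for `0 < r ≤ 1/2`, the operator `T₁ = [[1/√2, 0], [1/2, 1/√2]]` on `ℂ²`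
is invertible with `(1/2)‖v‖ ≤ ‖T₁v‖ ≤ ‖v‖` and `r‖v‖ ≤ ‖T₁v‖` (so `T₁ ∈ C_{1,r}`), but
testing the `C_α` inequality at `e₁ = (1,0)` gives `-r²/4 < 0`, so `T₁ ∉ C_α`. Hence the
inclusion `C_α ⊆ C_{1,r}` is strict for `0 < r ≤ 1/2`. -/
theorem stmt17 (r : ℝ) (hr0 : 0 < r) (hr1 : r ≤ 1 / 2)
    (T : EuclideanSpace ℂ (Fin 2) →L[ℂ] EuclideanSpace ℂ (Fin 2))
    (hT : ∀ v : EuclideanSpace ℂ (Fin 2),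
      T v 0 = v 0 / (Real.sqrt 2 : ℂ) ∧ T v 1 = v 0 / 2 + v 1 / (Real.sqrt 2 : ℂ)) :
    IsUnit T ∧
    (∀ v : EuclideanSpace ℂ (Fin 2), ‖T v‖ ≤ ‖v‖) ∧
    (∀ v : EuclideanSpace ℂ (Fin 2), (1 / 2) * ‖v‖ ≤ ‖T v‖) ∧
    (∀ v : EuclideanSpace ℂ (Fin 2), r * ‖v‖ ≤ ‖T v‖) ∧
    ((1 + r ^ 2) * ‖T (EuclideanSpace.single (0 : Fin 2) (1 : ℂ))‖ ^ 2
        - ‖T (T (EuclideanSpace.single (0 : Fin 2) (1 : ℂ)))‖ ^ 2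
        - r ^ 2 * ‖EuclideanSpace.single (0 : Fin 2) (1 : ℂ)‖ ^ 2 = -r ^ 2 / 4) ∧
    (-r ^ 2 / 4 < 0) ∧
    ¬ (∀ x : EuclideanSpace ℂ (Fin 2),
        0 ≤ (1 + r ^ 2) * ‖T x‖ ^ 2 - ‖T (T x)‖ ^ 2 - r ^ 2 * ‖x‖ ^ 2) := by
  obtain ⟨s, hs, hs2⟩ : ∃ s : ℝ, s ^ 2 = 1 / 2 ∧ ((Real.sqrt 2 : ℝ) : ℂ)⁻¹ = (s : ℂ) :=
    ⟨(Real.sqrt 2)⁻¹, by rw [inv_pow, Real.sq_sqrt (by norm_num)]; norm_num, by push_cast; rfl⟩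
  have h0 : ∀ v, (T v 0).re = s * (v 0).re ∧ (T v 0).im = s * (v 0).im := by
    intro v
    rw [(hT v).1, div_eq_mul_inv, hs2]
    constructor <;> simp <;> ring
  have h1 : ∀ v, (T v 1).re = (v 0).re / 2 + s * (v 1).re ∧
      (T v 1).im = (v 0).im / 2 + s * (v 1).im := by
    intro v
    rw [(hT v).2, div_eq_mul_inv (v 1), hs2]
    constructor <;> simp <;> ring
  have hn : ∀ v, ‖T v‖ ^ 2 = s ^ 2 * ((v 0).re ^ 2 + (v 0).im ^ 2) +
      (((v 0).re / 2 + s * (v 1).re) ^ 2 + ((v 0).im / 2 + s * (v 1).im) ^ 2) := by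
    intro v
    rw [normsq_aux, (h0 v).1, (h0 v).2, (h1 v).1, (h1 v).2]
    ring
  have hup : ∀ v, ‖T v‖ ≤ ‖v‖ := by
    intro v
    refine le_of_sq_le_aux (norm_nonneg _) ?_
    rw [hn, normsq_aux]
    have : 0 ≤ ((v 0).re / 2 - s * (v 1).re) ^ 2 + ((v 0).im / 2 - s * (v 1).im) ^ 2 := by positivity
    ring_nf at this ⊢
    rw [hs] at *
    linarith
  have hlo : ∀ v, (1 / 2) * ‖v‖ ≤ ‖T v‖ := by
    intro v
    refine le_of_sq_le_aux (norm_nonneg _) ?_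
    rw [mul_pow, hn, normsq_aux]
    have : 0 ≤ (s * (v 0).re + (v 1).re / 2) ^ 2 + (s * (v 0).im + (v 1).im / 2) ^ 2 := by positivity
    ring_nf at this ⊢
    rw [hs] at *
    linarith
  have he : (1 + r ^ 2) * ‖T (EuclideanSpace.single (0 : Fin 2) (1 : ℂ))‖ ^ 2
        - ‖T (T (EuclideanSpace.single (0 : Fin 2) (1 : ℂ)))‖ ^ 2
        - r ^ 2 * ‖EuclideanSpace.single (0 : Fin 2) (1 : ℂ)‖ ^ 2 = -r ^ 2 / 4 := by
    rw [hn (T _), hn, (h0 _).1, (h0 _).2, (h1 _).1, (h1 _).2, normsq_aux]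
    simp
    ring_nf
    have h4 : s ^ 4 = 1 / 4 := by rw [show s ^ 4 = (s ^ 2) ^ 2 by ring, hs]; norm_num
    rw [h4, hs]
    ring
  have hneg : -r ^ 2 / 4 < 0 := by nlinarith [pow_pos hr0 2]
  refine ⟨?_, hup, hlo, ?_, he, hneg, ?_⟩
  · rw [ContinuousLinearMap.isUnit_iff_bijective]
    have hi : Function.Injective (T : EuclideanSpace ℂ (Fin 2) →ₗ[ℂ] EuclideanSpace ℂ (Fin 2)) := by
      rw [injective_iff_map_eq_zero]
      intro v hv
      have h := hlo v
      have hv' : T v = 0 := hv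
      rw [hv', norm_zero] at h
      exact norm_le_zero_iff.1 (by linarith)
    exact ⟨hi, LinearMap.injective_iff_surjective.1 hi⟩
  · intro v
    exact (mul_le_mul_of_nonneg_right hr1 (norm_nonneg v)).trans (hlo v)
  · intro h
    have := h (EuclideanSpace.single (0 : Fin 2) (1 : ℂ))
    rw [he] at this
    linarith
end

section
/- Let 1/2<r<1 and let T₂ be the operator on ℂ² given by the matrix [[√r, 0], [1−r, √r]] (i.e., T₂(x,y) = (√r·x, (1−r)x + √r·y)). Then T₂ is invertible, r‖v‖ ≤ ‖T₂v‖ ≤ ‖v‖ for all v ∈ ℂ² (so ‖T₂‖ ≤ 1 and ‖T₂⁻¹‖ ≤ 1/r), but for e₁ = (1,0) one has (1+r²)‖T₂e₁‖² − ‖T₂²e₁‖² − r²‖e₁‖² = (r−1)²(r²−3r+1) < 0, so T₂ is not in the class C_α. Hence the inclusion C_α ⊆ C_{1,r} is strict for 1/2<r<1. -/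
/-- for `1/2 < r < 1`, the operator `T₂ = [[√r, 0], [1-r, √r]]` on `ℂ²` is
invertible with `r‖v‖ ≤ ‖T₂v‖ ≤ ‖v‖` (so `T₂ ∈ C_{1,r}`), but testing the `C_α`
inequality at `e₁ = (1,0)` gives `(r-1)²(r²-3r+1) < 0`, so `T₂ ∉ C_α`. Hence the
inclusion `C_α ⊆ C_{1,r}` is strict for `1/2 < r < 1`. -/
theorem stmt18 (r : ℝ) (hr0 : 1 / 2 < r) (hr1 : r < 1)
    (T : EuclideanSpace ℂ (Fin 2) →L[ℂ] EuclideanSpace ℂ (Fin 2))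
    (hT : ∀ v : EuclideanSpace ℂ (Fin 2),
      T v 0 = (Real.sqrt r : ℂ) * v 0 ∧
      T v 1 = ((1 - r : ℝ) : ℂ) * v 0 + (Real.sqrt r : ℂ) * v 1) :
    IsUnit T ∧
    (∀ v : EuclideanSpace ℂ (Fin 2), ‖T v‖ ≤ ‖v‖) ∧
    (∀ v : EuclideanSpace ℂ (Fin 2), r * ‖v‖ ≤ ‖T v‖) ∧
    ((1 + r ^ 2) * ‖T (EuclideanSpace.single (0 : Fin 2) (1 : ℂ))‖ ^ 2
        - ‖T (T (EuclideanSpace.single (0 : Fin 2) (1 : ℂ)))‖ ^ 2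
        - r ^ 2 * ‖EuclideanSpace.single (0 : Fin 2) (1 : ℂ)‖ ^ 2
      = (r - 1) ^ 2 * (r ^ 2 - 3 * r + 1)) ∧
    ((r - 1) ^ 2 * (r ^ 2 - 3 * r + 1) < 0) ∧
    ¬ (∀ x : EuclideanSpace ℂ (Fin 2),
        0 ≤ (1 + r ^ 2) * ‖T x‖ ^ 2 - ‖T (T x)‖ ^ 2 - r ^ 2 * ‖x‖ ^ 2) := by
  have hs : Real.sqrt r ^ 2 = r := Real.sq_sqrt (by linarith)
  obtain ⟨s, hs'⟩ : ∃ s, s = Real.sqrt r := ⟨_, rfl⟩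
  rw [← hs'] at hs hT
  have hn : ∀ v : EuclideanSpace ℂ (Fin 2),
      ‖v‖ ^ 2 = (v 0).re ^ 2 + (v 0).im ^ 2 + ((v 1).re ^ 2 + (v 1).im ^ 2) := by
    intro v
    rw [EuclideanSpace.norm_sq_eq, Fin.sum_univ_two, Complex.sq_norm, Complex.sq_norm,
      Complex.normSq_apply, Complex.normSq_apply]
    ring
  have hnT : ∀ v : EuclideanSpace ℂ (Fin 2),
      ‖T v‖ ^ 2 = (s * (v 0).re) ^ 2 + (s * (v 0).im) ^ 2
        + (((1 - r) * (v 0).re + s * (v 1).re) ^ 2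
          + ((1 - r) * (v 0).im + s * (v 1).im) ^ 2) := by
    intro v
    rw [hn, (hT v).1, (hT v).2]
    simp only [Complex.add_re, Complex.add_im, Complex.re_ofReal_mul, Complex.im_ofReal_mul]
  have hd : 0 ≤ 1 - r := by linarith
  have hup : ∀ v : EuclideanSpace ℂ (Fin 2), ‖T v‖ ≤ ‖v‖ := by
    intro v
    refine (sq_le_sq₀ (by positivity) (norm_nonneg _)).mp ?_
    have h : ‖v‖ ^ 2 - ‖T v‖ ^ 2 = (1 - r) * ((s * (v 0).re - (v 1).re) ^ 2
        + (s * (v 0).im - (v 1).im) ^ 2) := by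
      rw [hn v, hnT v, ← hs]
      ring
    have : 0 ≤ (1 - r) * ((s * (v 0).re - (v 1).re) ^ 2
        + (s * (v 0).im - (v 1).im) ^ 2) := by positivity
    linarith
  have hlow : ∀ v : EuclideanSpace ℂ (Fin 2), r * ‖v‖ ≤ ‖T v‖ := by
    intro v
    refine (sq_le_sq₀ (by positivity) (norm_nonneg _)).mp ?_
    have h : ‖T v‖ ^ 2 - (r * ‖v‖) ^ 2 = (1 - r) * (((v 0).re + s * (v 1).re) ^ 2
        + ((v 0).im + s * (v 1).im) ^ 2) := by
      rw [mul_pow, hn v, hnT v, ← hs]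
      ring
    have : 0 ≤ (1 - r) * (((v 0).re + s * (v 1).re) ^ 2
        + ((v 0).im + s * (v 1).im) ^ 2) := by positivity
    linarith
  have heq : (1 + r ^ 2) * ‖T (EuclideanSpace.single (0 : Fin 2) (1 : ℂ))‖ ^ 2
        - ‖T (T (EuclideanSpace.single (0 : Fin 2) (1 : ℂ)))‖ ^ 2
        - r ^ 2 * ‖EuclideanSpace.single (0 : Fin 2) (1 : ℂ)‖ ^ 2
      = (r - 1) ^ 2 * (r ^ 2 - 3 * r + 1) := by
    rw [hnT (T _), hnT, hn, (hT _).1, (hT _).2]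
    simp only [Complex.add_re, Complex.add_im, Complex.re_ofReal_mul, Complex.im_ofReal_mul]
    simp
    rw [← hs]
    ring
  have hneg : (r - 1) ^ 2 * (r ^ 2 - 3 * r + 1) < 0 := by
    apply mul_neg_of_pos_of_neg
    · have : r - 1 ≠ 0 := (sub_neg.mpr hr1).ne
      positivity
    · nlinarith
  refine ⟨?_, hup, hlow, heq, hneg, ?_⟩
  · have hinj : Function.Injective T := by
      rw [injective_iff_map_eq_zero]
      intro v hv
      have h := hlow v
      rw [hv, norm_zero] at h
      have : ‖v‖ ≤ 0 := by nlinarith [norm_nonneg v]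
      exact norm_le_zero_iff.mp this
    rw [ContinuousLinearMap.isUnit_iff_bijective]
    exact ⟨hinj, (LinearMap.injective_iff_surjective (f := T.toLinearMap)).mp hinj⟩
  · intro h
    have := h (EuclideanSpace.single (0 : Fin 2) (1 : ℂ))
    rw [heq] at this
    linarith
end

section
/- Let 0<r<1 and define weights w : ℤ → ℝ by w_n = (1−r²)r^{−2n} for n ≥ 0 and w_n = 1−r² for n ≤ −1. Let e₀ : ℤ → ℂ be the sequence with (e₀)_0 = 1 and (e₀)_n = 0 for n ≠ 0, and let F be the forward shift (Fh)_n = h_{n−1}. Then (1+r²)∑_n w_n|(Fe₀)_n|² − ∑_n w_n|(F²e₀)_n|² − r²∑_n w_n|(e₀)_n|² = (1−r²)²(r⁴−1)/r⁴ < 0. Consequently the forward shift F on the weighted space ℓ²_{r,−}(ℂ) (equivalently, the operator M_z on H²_r(𝔸)) does not belong to the class C_α, even though its adjoint, the backward shift on ℓ²_r(ℂ), does belong to C_α. -/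
/-- the forward shift `F` ((Fh)_n = h_{n-1}) on the weighted space
`ℓ²_{r,-}(ℂ)` (i.e. `M_z` on `H²_r(𝔸)`), with weights `w_n = (1-r²)r^{-2n}` for `n ≥ 0`
and `w_n = 1-r²` for `n ≤ -1`, fails the `C_α` inequality at the sequence `e₀`: one has
`(1+r²)∑ wₙ|(Fe₀)ₙ|² - ∑ wₙ|(F²e₀)ₙ|² - r²∑ wₙ|(e₀)ₙ|² = (1-r²)²(r⁴-1)/r⁴ < 0`, so `F`
does not belong to `C_α` (even though its adjoint, the backward shift on `ℓ²_r(ℂ)`,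
does). -/
theorem stmt19 (r : ℝ) (hr0 : 0 < r) (hr1 : r < 1)
    (w : ℤ → ℝ)
    (hw : ∀ n : ℤ, w n = if 0 ≤ n then (1 - r ^ 2) * r ^ (-2 * n) else 1 - r ^ 2)
    (e₀ : ℤ → ℂ) (he₀ : e₀ 0 = 1) (he₀' : ∀ n : ℤ, n ≠ 0 → e₀ n = 0) :
    ((1 + r ^ 2) * (∑' n : ℤ, w n * ‖e₀ (n - 1)‖ ^ 2) - (∑' n : ℤ, w n * ‖e₀ (n - 2)‖ ^ 2)
        - r ^ 2 * (∑' n : ℤ, w n * ‖e₀ n‖ ^ 2)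
      = (1 - r ^ 2) ^ 2 * (r ^ 4 - 1) / r ^ 4) ∧
    ((1 - r ^ 2) ^ 2 * (r ^ 4 - 1) / r ^ 4 < 0) ∧
    ¬ (∀ g : ℤ → ℂ, Summable (fun n : ℤ => w n * ‖g n‖ ^ 2) →
        0 ≤ (1 + r ^ 2) * (∑' n : ℤ, w n * ‖g (n - 1)‖ ^ 2)
            - (∑' n : ℤ, w n * ‖g (n - 2)‖ ^ 2)
            - r ^ 2 * (∑' n : ℤ, w n * ‖g n‖ ^ 2)) := by
  have key : ∀ k : ℤ, ∑' n : ℤ, w n * ‖e₀ (n - k)‖ ^ 2 = w k := by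
    intro k
    rw [tsum_eq_single k]
    · simp [he₀]
    · intro n hn
      rw [he₀' (n - k) (sub_ne_zero.mpr hn)]
      simp
  have key0 : ∑' n : ℤ, w n * ‖e₀ n‖ ^ 2 = w 0 := by
    simpa using key 0
  have h0 : w 0 = 1 - r ^ 2 := by rw [hw]; simp
  have h1 : w 1 = (1 - r ^ 2) / r ^ 2 := by
    rw [hw, if_pos (by norm_num), div_eq_mul_inv, mul_one, zpow_neg]
    norm_cast
  have h2 : w 2 = (1 - r ^ 2) / r ^ 4 := by
    rw [hw, if_pos (by norm_num), div_eq_mul_inv, show (-2 * 2 : ℤ) = -4 by norm_num, zpow_neg]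
    norm_cast
  have heq : (1 + r ^ 2) * (∑' n : ℤ, w n * ‖e₀ (n - 1)‖ ^ 2)
        - (∑' n : ℤ, w n * ‖e₀ (n - 2)‖ ^ 2) - r ^ 2 * (∑' n : ℤ, w n * ‖e₀ n‖ ^ 2)
      = (1 - r ^ 2) ^ 2 * (r ^ 4 - 1) / r ^ 4 := by
    rw [key, key, key0, h0, h1, h2]
    field_simp
    ring
  have hneg : (1 - r ^ 2) ^ 2 * (r ^ 4 - 1) / r ^ 4 < 0 := by
    have a : r ^ 2 < 1 := pow_lt_one₀ hr0.le hr1 (by norm_num)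
    have b : r ^ 4 < 1 := pow_lt_one₀ hr0.le hr1 (by norm_num)
    exact div_neg_of_neg_of_pos
      (mul_neg_of_pos_of_neg (pow_pos (by linarith) 2) (by linarith)) (by positivity)
  refine ⟨heq, hneg, fun h => ?_⟩
  have hs : Summable (fun n : ℤ => w n * ‖e₀ n‖ ^ 2) := by
    apply summable_of_ne_finset_zero (s := {0})
    intro n hn
    rw [he₀' n (by simpa using hn)]
    simp
  have := h e₀ hs
  rw [heq] at this
  linarith
end
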